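/- Let u be a weak supersolution of ∂ₜu + 𝓛u = Δu in Ω × (0,T) with u ≥ 0 on B_R(x₀) × (t₀ − r², t₀ + r²), where B_R(x₀) × (t₀ − r², t₀ + r²) ⊂ Ω × (0,T), 0 < r ≤ 1 and r < R/2. Let d > 0 and set v = u + l with l = (r/R)² · Tail_∞(u₋; x₀, R, t₀ − r², t₀ + r²) + d. Let C₀ > 0 and let ψ ∈ C_c^∞(B_{3r/2}(x₀)) be nonnegative, radially decreasing about x₀ (i.e. ψ(x) = g(|x − x₀|) with g nonincreasing), with 0 ≤ ψ ≤ 1, ψ ≡ 1 on B_r(x₀) and |∇ψ| ≤ C₀/r on B_{3r/2}(x₀). Define b = − ( ∫_{B_{3r/2}(x₀)} log v(x, t₀) ψ(x)² dx ) / ( ∫_{B_{3r/2}(x₀)} ψ(x)² dx ). Then there exists a constant C > 0 depending only on N, s, Λ and C₀ such that for every λ > 0: |{ (x,t) ∈ B_r(x₀) × (t₀, t₀ + r²) : log v(x,t) < −λ − b }| ≤ C r^{N+2} / λ. -/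

import Mathlib

open MeasureTheory Metric Set
open scoped RealInnerProductSpace ENNReal

noncomputable section

/-- Euclidean space `ℝ^N`. -/
abbrev E (N : ℕ) : Type := EuclideanSpace ℝ (Fin N)

/-- The kernel `K` is measurable, symmetric in its first two arguments, and comparable to
the fractional kernel `|x-y|^{-(N+2s)}` with constant `Λ`, uniformly for `t ∈ (0,T)`. -/
def KernelOK (N : ℕ) (s Λ T : ℝ) (K : E N → E N → ℝ → ℝ) : Prop :=
  Measurable (fun p : E N × E N × ℝ => K p.1 p.2.1 p.2.2) ∧
  (∀ x y t, K x y t = K y x t) ∧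
  ∀ x y : E N, x ≠ y → ∀ t ∈ Set.Ioo 0 T,
    Λ⁻¹ * ‖x - y‖ ^ (-((N : ℝ) + 2 * s)) ≤ K x y t ∧
      K x y t ≤ Λ * ‖x - y‖ ^ (-((N : ℝ) + 2 * s))

/-- `u` is a (bounded, measurable, smooth in `Ω × (0,T)`) weak supersolution of
`∂ₜ u + 𝓛 u = Δ u` in `Ω × (0,T)`. -/
def IsWeakSupersolution (N : ℕ) (T : ℝ) (K : E N → E N → ℝ → ℝ)
    (Ω : Set (E N)) (u : E N → ℝ → ℝ) : Prop :=
  Measurable (fun p : E N × ℝ => u p.1 p.2) ∧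
  (∃ M : ℝ, ∀ x t, t ∈ Set.Ioo 0 T → |u x t| ≤ M) ∧
  ContDiffOn ℝ (⊤ : ℕ∞) (fun p : E N × ℝ => u p.1 p.2) (Ω ×ˢ Set.Ioo 0 T) ∧
  ∀ φ : E N → ℝ → ℝ,
    ContDiff ℝ (⊤ : ℕ∞) (fun p : E N × ℝ => φ p.1 p.2) →
    HasCompactSupport (fun p : E N × ℝ => φ p.1 p.2) →
    tsupport (fun p : E N × ℝ => φ p.1 p.2) ⊆ Ω ×ˢ Set.Ioo 0 T →
    (∀ x t, 0 ≤ φ x t) →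
    0 ≤ -(∫ t in Set.Ioo 0 T, ∫ x in Ω, u x t * deriv (fun τ => φ x τ) t) +
        (∫ t in Set.Ioo 0 T, ∫ x in Ω,
          ⟪gradient (fun y => u y t) x, gradient (fun y => φ y t) x⟫) +
        ∫ t in Set.Ioo 0 T, ∫ x : E N, ∫ y : E N,
          (u x t - u y t) * (φ x t - φ y t) * K x y t

/-- The negative part `u₋ = max(-u, 0)`. -/
def uminus (N : ℕ) (u : E N → ℝ → ℝ) : E N → ℝ → ℝ := fun x t => max (-(u x t)) 0

/-- The parabolic tail `Tail_∞(w; x₀, ρ, t₁, t₂)`. -/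
def tailInfty (N : ℕ) (s : ℝ) (w : E N → ℝ → ℝ) (x₀ : E N) (ρ t₁ t₂ : ℝ) : ℝ :=
  ρ ^ 2 * essSup
      (fun t => ∫ y in (Metric.ball x₀ ρ)ᶜ, |w y t| * ‖y - x₀‖ ^ (-((N : ℝ) + 2 * s)))
      (volume.restrict (Set.Ioo t₁ t₂))

lemma aux_ofReal_integral_le {α : Type*} [MeasurableSpace α] {μ : Measure α} (f : α → ℝ) :
    ENNReal.ofReal (∫ a, f a ∂μ) ≤ ∫⁻ a, ENNReal.ofReal (f a) ∂μ := by
  by_cases hf : Integrable f μ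
  · rw [integral_eq_lintegral_pos_part_sub_lintegral_neg_part hf]
    refine (ENNReal.ofReal_le_ofReal (sub_le_self _ ENNReal.toReal_nonneg)).trans ?_
    exact ENNReal.ofReal_toReal_le
  · rw [integral_undef hf]; simp

lemma aux_integral_le {α : Type*} [MeasurableSpace α] {μ : Measure α} (f : α → ℝ) {c : ℝ}
    (hc : 0 ≤ c) (h : ∫⁻ a, ENNReal.ofReal (f a) ∂μ ≤ ENNReal.ofReal c) :
    ∫ a, f a ∂μ ≤ c :=
  (ENNReal.ofReal_le_ofReal_iff hc).1 ((aux_ofReal_integral_le f).trans h)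

lemma aux_sq_integral_le (f : ℝ → ℝ) (hf : ContinuousOn f (Icc 0 1)) :
    (∫ τ in (0:ℝ)..1, f τ) ^ 2 ≤ ∫ τ in (0:ℝ)..1, f τ ^ 2 := by
  set c := ∫ τ in (0:ℝ)..1, f τ with hc
  have hu : uIcc (0:ℝ) 1 = Icc 0 1 := uIcc_of_le zero_le_one
  have h1 : IntervalIntegrable f volume 0 1 := ContinuousOn.intervalIntegrable (by rwa [hu])
  have h2 : IntervalIntegrable (fun τ => f τ ^ 2) volume 0 1 :=
    ContinuousOn.intervalIntegrable (by rw [hu]; exact hf.pow 2)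
  have h0 : 0 ≤ ∫ τ in (0:ℝ)..1, (f τ - c) ^ 2 :=
    intervalIntegral.integral_nonneg zero_le_one (fun _ _ => sq_nonneg _)
  have : ∫ τ in (0:ℝ)..1, (f τ - c) ^ 2 = (∫ τ in (0:ℝ)..1, f τ ^ 2) - c ^ 2 := by
    have e : ∀ τ, (f τ - c) ^ 2 = f τ ^ 2 - (2 * c) * f τ + c ^ 2 := fun τ => by ring
    simp_rw [e]
    rw [intervalIntegral.integral_add (h2.sub (h1.const_mul _)) (by simp),
      intervalIntegral.integral_sub h2 (h1.const_mul _), intervalIntegral.integral_const_mul, ← hc]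
    simp; ring
  linarith

lemma aux_segment {F : Type*} [NormedAddCommGroup F] [NormedSpace ℝ F]
    (w : F → ℝ) (S : Set F) (hS : IsOpen S) (hconv : Convex ℝ S)
    (hw : ContDiffOn ℝ 1 w S) {x y : F} (hx : x ∈ S) (hy : y ∈ S) :
    (w x - w y) ^ 2 ≤ ‖x - y‖ ^ 2 * ∫ τ in (0:ℝ)..1, ‖fderiv ℝ w (x + τ • (y - x))‖ ^ 2 := by
  have hz : ∀ τ ∈ Icc (0:ℝ) 1, x + τ • (y - x) ∈ S := fun τ hτ =>
    hconv.add_smul_sub_mem hx hy hτ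
  have hcd : ContinuousOn (fderiv ℝ w) S := hw.continuousOn_fderiv_of_isOpen hS le_rfl
  have hline : Continuous (fun τ : ℝ => x + τ • (y - x)) := by fun_prop
  have hc1 : ContinuousOn (fun τ : ℝ => fderiv ℝ w (x + τ • (y - x))) (Icc 0 1) :=
    hcd.comp hline.continuousOn hz
  have hder : ∀ τ ∈ uIcc (0:ℝ) 1, HasDerivAt (fun τ : ℝ => w (x + τ • (y - x)))
      (fderiv ℝ w (x + τ • (y - x)) (y - x)) τ := by
    intro τ hτ
    rw [uIcc_of_le zero_le_one] at hτ
    have hd : DifferentiableAt ℝ w (x + τ • (y - x)) :=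
      (hw.differentiableOn one_ne_zero).differentiableAt (hS.mem_nhds (hz τ hτ))
    have hl : HasDerivAt (fun τ : ℝ => x + τ • (y - x)) (y - x) τ := by
      simpa using ((hasDerivAt_id τ).smul_const (y - x)).const_add x
    exact hd.hasFDerivAt.comp_hasDerivAt τ hl
  have hc2 : ContinuousOn (fun τ : ℝ => fderiv ℝ w (x + τ • (y - x)) (y - x)) (Icc 0 1) :=
    hc1.clm_apply continuousOn_const
  have hftc := intervalIntegral.integral_eq_sub_of_hasDerivAt hder
    (ContinuousOn.intervalIntegrable (by rwa [uIcc_of_le zero_le_one]))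
  have h1 : (w x - w y) ^ 2 = (∫ τ in (0:ℝ)..1, fderiv ℝ w (x + τ • (y - x)) (y - x)) ^ 2 := by
    rw [hftc]; simp; ring
  rw [h1]
  refine (aux_sq_integral_le _ hc2).trans ?_
  rw [← intervalIntegral.integral_const_mul]
  apply intervalIntegral.integral_mono_on zero_le_one
  · exact ContinuousOn.intervalIntegrable (by rw [uIcc_of_le zero_le_one]; exact hc2.pow 2)
  · refine ContinuousOn.intervalIntegrable ?_
    rw [uIcc_of_le zero_le_one]
    exact continuousOn_const.mul (hc1.norm.pow 2)
  · intro τ hτ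
    have := (fderiv ℝ w (x + τ • (y - x))).le_opNorm (y - x)
    rw [← mul_pow, ← sq_abs, ← Real.norm_eq_abs, norm_sub_rev x y, mul_comm]
    gcongr

lemma aux_lintegral_affine {N : ℕ} (H : E N → ℝ) (hH : Continuous H) (hn : ∀ z, 0 ≤ H z)
    (hi : Integrable H) (a : E N) {τ : ℝ} (hτ : 1 / 2 ≤ τ) :
    ∫⁻ y, ENNReal.ofReal (H (a + τ • y)) ≤ ENNReal.ofReal (2 ^ N) * ENNReal.ofReal (∫ z, H z) := by
  have hτ0 : τ ≠ 0 := by linarith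
  have h1 : Integrable (fun z => H (a + z)) := hi.comp_add_left a
  have h2 : Integrable (fun y => H (a + τ • y)) := h1.comp_smul hτ0
  rw [← ofReal_integral_eq_lintegral_ofReal h2 (Filter.Eventually.of_forall fun y => hn _),
    Measure.integral_comp_smul volume (fun z => H (a + z)) τ, integral_add_left_eq_self H a,
    ← ENNReal.ofReal_mul (by positivity)]
  apply ENNReal.ofReal_le_ofReal
  have : 0 ≤ ∫ z, H z := integral_nonneg hn
  rw [smul_eq_mul]
  gcongr
  rw [finrank_euclideanSpace_fin, abs_of_nonneg (by positivity), ← inv_pow]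
  gcongr
  rw [inv_le_comm₀ (by linarith) (by norm_num)]
  linarith

lemma aux_double {N : ℕ} (H : E N → ℝ) (hH : Continuous H) (hn : ∀ z, 0 ≤ H z)
    (hi : Integrable H) (B : Set (E N)) (hB : volume B ≠ ⊤) :
    ∫⁻ x in B, ∫⁻ y in B, ∫⁻ τ in Ioc (0:ℝ) 1, ENNReal.ofReal (H (x + τ • (y - x))) ≤
      volume B * (ENNReal.ofReal (2 ^ N) * ENNReal.ofReal (∫ z, H z)) := by
  have : IsFiniteMeasure (volume.restrict B) := ⟨by simpa using hB.lt_top⟩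
  set μ := volume.restrict B
  have hm : Measurable (fun q : (E N × E N) × ℝ =>
      ENNReal.ofReal (H (q.1.1 + q.2 • (q.1.2 - q.1.1)))) := by
    have : Continuous (fun q : (E N × E N) × ℝ => H (q.1.1 + q.2 • (q.1.2 - q.1.1))) := by fun_prop
    exact this.measurable.ennreal_ofReal
  have hmτ : ∀ τ : ℝ, Measurable (fun q : (E N × E N) =>
      ENNReal.ofReal (H (q.1 + τ • (q.2 - q.1)))) := by
    intro τ
    have : Continuous (fun q : (E N × E N) => H (q.1 + τ • (q.2 - q.1))) := by fun_prop
    exact this.measurable.ennreal_ofReal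
  have e1 : ∫⁻ x, ∫⁻ y, (∫⁻ τ in Ioc (0:ℝ) 1, ENNReal.ofReal (H (x + τ • (y - x)))) ∂μ ∂μ =
      ∫⁻ p, (∫⁻ τ in Ioc (0:ℝ) 1, ENNReal.ofReal (H (p.1 + τ • (p.2 - p.1)))) ∂(μ.prod μ) := by
    rw [lintegral_prod]
    exact (Measurable.lintegral_prod_right' hm).aemeasurable
  rw [e1, lintegral_lintegral_swap hm.aemeasurable]
  have key : ∀ τ ∈ Ioc (0:ℝ) 1,
      ∫⁻ p, ENNReal.ofReal (H (p.1 + τ • (p.2 - p.1))) ∂(μ.prod μ) ≤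
      volume B * (ENNReal.ofReal (2 ^ N) * ENNReal.ofReal (∫ z, H z)) := by
    intro τ hτ
    have fin : ∀ f : E N → ℝ≥0∞, (∀ x, f x ≤ ENNReal.ofReal (2 ^ N) * ENNReal.ofReal (∫ z, H z)) →
        ∫⁻ x, f x ∂μ ≤ volume B * (ENNReal.ofReal (2 ^ N) * ENNReal.ofReal (∫ z, H z)) := by
      intro f hf
      refine (lintegral_mono hf).trans ?_
      rw [lintegral_const, mul_comm]; simp [μ]
    rcases le_total (1/2) τ with h | h
    · rw [lintegral_prod _ (hmτ τ).aemeasurable]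
      apply fin
      intro x
      refine (setLIntegral_le_lintegral _ _).trans ?_
      refine le_trans (le_of_eq ?_) (aux_lintegral_affine H hH hn hi ((1 - τ) • x) h)
      congr 1; ext y; congr 2; module
    · rw [lintegral_prod_symm _ (hmτ τ).aemeasurable]
      apply fin
      intro y
      refine (setLIntegral_le_lintegral _ _).trans ?_
      refine le_trans (le_of_eq ?_) (aux_lintegral_affine H hH hn hi (τ • y) (τ := 1 - τ) (by linarith))
      congr 1; ext y; congr 2; module
  refine (setLIntegral_mono' measurableSet_Ioc key).trans ?_
  simp

lemma poincare_weighted {N : ℕ} (hN : 2 ≤ N) (x₀ : E N) {r R : ℝ} (hr : 0 < r)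
    (hrR : 3 * r / 2 < R) (w ψ : E N → ℝ) (hw : ContDiffOn ℝ 1 w (ball x₀ R))
    (hψ : Continuous ψ) (hcs : HasCompactSupport ψ) (hsup : tsupport ψ ⊆ ball x₀ (3 * r / 2))
    (h0 : ∀ x, 0 ≤ ψ x) (h1 : ∀ x, ψ x ≤ 1)
    (hg : ∃ g : ℝ → ℝ, AntitoneOn g (Set.Ici 0) ∧ ∀ x, ψ x = g ‖x - x₀‖)
    (hone : ∀ x ∈ ball x₀ r, ψ x = 1) :
    ∫⁻ x in ball x₀ r, ENNReal.ofReal ((w x - (∫ y, w y * ψ y ^ 2) / ∫ y, ψ y ^ 2) ^ 2) ≤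
      ENNReal.ofReal (9 * r ^ 2 * 3 ^ N * ∫ z, ψ z ^ 2 * ‖fderiv ℝ w z‖ ^ 2) := by
  have : Nonempty (Fin N) := ⟨⟨0, by omega⟩⟩
  have : Nontrivial (E N) := inferInstance
  set B := ball x₀ (3 * r / 2) with hBdef
  have hBsub : B ⊆ ball x₀ R := ball_subset_ball hrR.le
  have hwB : ContDiffOn ℝ 1 w B := hw.mono hBsub
  have hwc : ContinuousOn w B := hwB.continuousOn
  have hdc : ContinuousOn (fderiv ℝ w) B := hwB.continuousOn_fderiv_of_isOpen isOpen_ball le_rfl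
  have hz : ∀ x, x ∉ B → ψ x = 0 := fun x hx => image_eq_zero_of_notMem_tsupport fun h => hx (hsup h)
  -- general integrability
  have gen : ∀ f : E N → ℝ, ContinuousOn f B → Continuous (fun x => ψ x ^ 2 * f x) ∧
      Integrable (fun x => ψ x ^ 2 * f x) := by
    intro f hf
    have hcs2 : HasCompactSupport (fun x => ψ x ^ 2 * f x) := by
      apply hcs.mono
      intro x hx
      simp only [Function.mem_support] at hx ⊢
      intro h; apply hx; simp [h]
    have hts : tsupport (fun x => ψ x ^ 2 * f x) ⊆ B := by
      refine subset_trans ?_ hsup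
      apply closure_mono
      intro x hx
      simp only [Function.mem_support] at hx ⊢
      intro h; apply hx; simp [h]
    have hc : Continuous (fun x => ψ x ^ 2 * f x) :=
      ContinuousOn.continuous_of_tsupport_subset ((hψ.pow 2).continuousOn.mul hf) isOpen_ball hts
    exact ⟨hc, hc.integrable_of_hasCompactSupport hcs2⟩
  set H : E N → ℝ := fun z => ψ z ^ 2 * ‖fderiv ℝ w z‖ ^ 2 with hHdef
  obtain ⟨hHc, hHi⟩ := gen (fun z => ‖fderiv ℝ w z‖ ^ 2) (hdc.norm.pow 2)
  have hHn : ∀ z, 0 ≤ H z := fun z => by positivity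
  set A := ∫ y, ψ y ^ 2 with hA
  set V := (∫ y, w y * ψ y ^ 2) / A with hV
  have hψi : Integrable (fun y => ψ y ^ 2) := by
    simpa using (gen (fun _ => 1) continuousOn_const).2
  have hwi : Integrable (fun y => w y * ψ y ^ 2) := by
    simpa [mul_comm] using (gen w hwc).2
  have hw2i : Integrable (fun y => w y ^ 2 * ψ y ^ 2) := by
    refine (gen (fun y => w y ^ 2) (hwc.pow 2)).2.congr (Filter.Eventually.of_forall fun y => mul_comm _ _)
  have hvolr : volume (ball x₀ r) ≤ ENNReal.ofReal A := by
    rw [hA, ofReal_integral_eq_lintegral_ofReal hψi (Filter.Eventually.of_forall fun y => sq_nonneg _)]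
    calc volume (ball x₀ r) = ∫⁻ x in ball x₀ r, 1 := by simp
      _ ≤ ∫⁻ x in ball x₀ r, ENNReal.ofReal (ψ x ^ 2) := by
          apply setLIntegral_mono' measurableSet_ball
          intro x hx; simp [hone x hx]
      _ ≤ _ := setLIntegral_le_lintegral _ _
  have hApos : 0 < A := by
    have : 0 < volume (ball x₀ r) := measure_ball_pos _ _ hr
    exact ENNReal.ofReal_pos.1 (this.trans_le hvolr)
  have hvolB : volume B ≤ ENNReal.ofReal ((3/2) ^ N * A) := by
    have e1 : volume B = ENNReal.ofReal ((3/2) ^ N) * volume (ball x₀ r) := by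
      rw [hBdef, Measure.addHaar_ball volume x₀ (by positivity),
        Measure.addHaar_ball volume x₀ hr.le, ← mul_assoc, ← ENNReal.ofReal_mul (by positivity),
        finrank_euclideanSpace_fin, ← mul_pow]
      congr 3; ring
    rw [e1, ENNReal.ofReal_mul (by positivity)]
    gcongr
  -- lower bound
  have hlow : ∀ c : ℝ, A * (c - V) ^ 2 ≤ ∫ y, (c - w y) ^ 2 * ψ y ^ 2 := by
    intro c
    have e : ∀ c : ℝ, ∫ y, (c - w y) ^ 2 * ψ y ^ 2 = c ^ 2 * A - 2 * c * (∫ y, w y * ψ y ^ 2)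
        + ∫ y, w y ^ 2 * ψ y ^ 2 := by
      intro c
      have e1 : (fun y => (c - w y) ^ 2 * ψ y ^ 2) = ((fun y => c ^ 2 * ψ y ^ 2) -
        (fun y => 2 * c * (w y * ψ y ^ 2))) + (fun y => w y ^ 2 * ψ y ^ 2) := by
        ext y; simp only [Pi.add_apply, Pi.sub_apply]; ring
      rw [e1, integral_add' ((hψi.const_mul _).sub (hwi.const_mul _)) hw2i,
        integral_sub' (hψi.const_mul _) (hwi.const_mul _), integral_const_mul, integral_const_mul]
    have h0' : 0 ≤ ∫ y, (V - w y) ^ 2 * ψ y ^ 2 := integral_nonneg fun y => by positivity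
    rw [e] at h0' ⊢
    have hVA : ∫ y, w y * ψ y ^ 2 = V * A := by rw [hV]; field_simp
    rw [hVA] at h0' ⊢
    nlinarith
  -- pointwise upper bound
  have hup : ∀ x ∈ B, ∀ y ∈ B, ENNReal.ofReal (ψ x ^ 2 * ((w x - w y) ^ 2 * ψ y ^ 2)) ≤
      ENNReal.ofReal (9 * r ^ 2) *
        ∫⁻ τ in Ioc (0:ℝ) 1, ENNReal.ofReal (H (x + τ • (y - x))) := by
    intro x hx y hy
    have hline : Continuous (fun τ : ℝ => x + τ • (y - x)) := by fun_prop
    have hseg := aux_segment w B isOpen_ball (convex_ball _ _) hwB hx hy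
    have hz : ∀ τ ∈ Icc (0:ℝ) 1, x + τ • (y - x) ∈ B := fun τ hτ =>
      (convex_ball _ _).add_smul_sub_mem hx hy hτ
    have hHi' : IntegrableOn (fun τ : ℝ => H (x + τ • (y - x))) (Ioc 0 1) :=
      ((hHc.comp hline).continuousOn (s := Icc 0 1)).integrableOn_Icc.mono_set Ioc_subset_Icc_self
    rw [← ofReal_integral_eq_lintegral_ofReal hHi' (Filter.Eventually.of_forall fun y => hHn _),
      ← ENNReal.ofReal_mul (by positivity)]
    apply ENNReal.ofReal_le_ofReal
    rw [← intervalIntegral.integral_of_le zero_le_one]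
    have hxy : ‖x - y‖ ^ 2 ≤ 9 * r ^ 2 := by
      have : ‖x - y‖ ≤ 3 * r := by
        rw [← dist_eq_norm]
        have h1 := mem_ball.1 hx
        have h2 := mem_ball.1 hy
        have := dist_triangle_right x y x₀
        linarith
      calc ‖x - y‖ ^ 2 ≤ (3 * r) ^ 2 := by gcongr
        _ = _ := by ring
    have hI0 : 0 ≤ ∫ τ in (0:ℝ)..1, ‖fderiv ℝ w (x + τ • (y - x))‖ ^ 2 :=
      intervalIntegral.integral_nonneg zero_le_one (fun _ _ => by positivity)
    calc ψ x ^ 2 * ((w x - w y) ^ 2 * ψ y ^ 2) = (ψ x ^ 2 * ψ y ^ 2) * (w x - w y) ^ 2 := by ring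
      _ ≤ (ψ x ^ 2 * ψ y ^ 2) * (9 * r ^ 2 * ∫ τ in (0:ℝ)..1, ‖fderiv ℝ w (x + τ • (y - x))‖ ^ 2) := by
          gcongr
          exact hseg.trans (by gcongr)
      _ = 9 * r ^ 2 * ∫ τ in (0:ℝ)..1, (ψ x ^ 2 * ψ y ^ 2) * ‖fderiv ℝ w (x + τ • (y - x))‖ ^ 2 := by
          rw [intervalIntegral.integral_const_mul]; ring
      _ ≤ _ := by
          gcongr
          have hc1 : ContinuousOn (fun τ : ℝ => ‖fderiv ℝ w (x + τ • (y - x))‖ ^ 2) (Icc 0 1) :=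
            (hdc.comp hline.continuousOn hz).norm.pow 2
          apply intervalIntegral.integral_mono_on zero_le_one
          · refine ContinuousOn.intervalIntegrable ?_
            rw [uIcc_of_le zero_le_one]
            exact continuousOn_const.mul hc1
          · exact (hHc.comp hline).intervalIntegrable _ _
          · intro τ hτ
            simp only [hHdef]
            have hmin : ψ x ^ 2 * ψ y ^ 2 ≤ ψ (x + τ • (y - x)) ^ 2 := by
              obtain ⟨g, hga, hgψ⟩ := hg
              have hnorm : ‖x + τ • (y - x) - x₀‖ ≤ max ‖x - x₀‖ ‖y - x₀‖ := by
                have : x + τ • (y - x) - x₀ = (1 - τ) • (x - x₀) + τ • (y - x₀) := by module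
                rw [this]
                refine (norm_add_le _ _).trans ?_
                rw [norm_smul, norm_smul, Real.norm_of_nonneg (by linarith [hτ.2]),
                  Real.norm_of_nonneg hτ.1]
                have a1 := mul_le_mul_of_nonneg_left (le_max_left ‖x - x₀‖ ‖y - x₀‖) (by linarith [hτ.2] : (0:ℝ) ≤ 1 - τ)
                have a2 := mul_le_mul_of_nonneg_left (le_max_right ‖x - x₀‖ ‖y - x₀‖) hτ.1
                linarith
              have hx1 : ψ x ^ 2 ≤ 1 := pow_le_one₀ (h0 x) (h1 x)
              have hy1 : ψ y ^ 2 ≤ 1 := pow_le_one₀ (h0 y) (h1 y)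
              rcases le_max_iff.1 hnorm with h | h
              · have : ψ x ≤ ψ (x + τ • (y - x)) := by
                  rw [hgψ x, hgψ (x + τ • (y - x))]
                  exact hga (norm_nonneg _) (norm_nonneg _) h
                calc ψ x ^ 2 * ψ y ^ 2 ≤ ψ x ^ 2 * 1 := by gcongr
                  _ = ψ x ^ 2 := mul_one _
                  _ ≤ _ := pow_le_pow_left₀ (h0 x) this 2
              · have : ψ y ≤ ψ (x + τ • (y - x)) := by
                  rw [hgψ y, hgψ (x + τ • (y - x))]
                  exact hga (norm_nonneg _) (norm_nonneg _) h
                calc ψ x ^ 2 * ψ y ^ 2 ≤ 1 * ψ y ^ 2 := by gcongr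
                  _ = ψ y ^ 2 := one_mul _
                  _ ≤ _ := pow_le_pow_left₀ (h0 y) this 2
            exact mul_le_mul_of_nonneg_right hmin (by positivity)
  -- combine
  have hint : ∀ x, ENNReal.ofReal (A * (w x - V) ^ 2) ≤
      ∫⁻ y in B, ENNReal.ofReal ((w x - w y) ^ 2 * ψ y ^ 2) := by
    intro x
    refine (ENNReal.ofReal_le_ofReal (hlow (w x))).trans ?_
    rw [← setIntegral_eq_integral_of_forall_compl_eq_zero (s := B)]
    · exact aux_ofReal_integral_le _
    · intro y hy; simp [hz y hy]
  have hfin : volume B ≠ ⊤ := measure_ball_lt_top.ne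
  have hD : ENNReal.ofReal A * ∫⁻ x in ball x₀ r, ENNReal.ofReal ((w x - V) ^ 2) ≤
      ENNReal.ofReal A * ENNReal.ofReal (9 * r ^ 2 * 3 ^ N * ∫ z, H z) := by
    calc ENNReal.ofReal A * ∫⁻ x in ball x₀ r, ENNReal.ofReal ((w x - V) ^ 2)
        = ∫⁻ x in ball x₀ r, ENNReal.ofReal (A * (w x - V) ^ 2) := by
          rw [← lintegral_const_mul' _ _ ENNReal.ofReal_ne_top]
          simp_rw [ENNReal.ofReal_mul hApos.le]
      _ ≤ ∫⁻ x in ball x₀ r, ∫⁻ y in B, ENNReal.ofReal (ψ x ^ 2 * ((w x - w y) ^ 2 * ψ y ^ 2)) := by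
          apply setLIntegral_mono' measurableSet_ball
          intro x hx
          simpa [hone x hx] using hint x
      _ ≤ ∫⁻ x in B, ∫⁻ y in B, ENNReal.ofReal (ψ x ^ 2 * ((w x - w y) ^ 2 * ψ y ^ 2)) :=
          lintegral_mono_set (ball_subset_ball (by linarith))
      _ ≤ ∫⁻ x in B, ∫⁻ y in B, ENNReal.ofReal (9 * r ^ 2) *
            ∫⁻ τ in Ioc (0:ℝ) 1, ENNReal.ofReal (H (x + τ • (y - x))) := by
          apply setLIntegral_mono' measurableSet_ball
          intro x hx
          apply setLIntegral_mono' measurableSet_ball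
          intro y hy
          exact hup x hx y hy
      _ = ENNReal.ofReal (9 * r ^ 2) * ∫⁻ x in B, ∫⁻ y in B,
            ∫⁻ τ in Ioc (0:ℝ) 1, ENNReal.ofReal (H (x + τ • (y - x))) := by
          simp_rw [lintegral_const_mul' _ _ ENNReal.ofReal_ne_top]
      _ ≤ ENNReal.ofReal (9 * r ^ 2) * (ENNReal.ofReal ((3/2) ^ N * A) *
            (ENNReal.ofReal (2 ^ N) * ENNReal.ofReal (∫ z, H z))) := by
          gcongr
          exact (aux_double H hHc hHn hHi B hfin).trans (by gcongr)
      _ = _ := by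
          have hHI : 0 ≤ ∫ z, H z := integral_nonneg hHn
          rw [← ENNReal.ofReal_mul (by positivity), ← ENNReal.ofReal_mul (by positivity),
            ← ENNReal.ofReal_mul (by positivity), ← ENNReal.ofReal_mul (by positivity)]
          congr 1
          have : (3:ℝ) ^ N = (3/2) ^ N * 2 ^ N := by rw [← mul_pow]; norm_num
          rw [this]; ring
  exact (ENNReal.mul_le_mul_iff_right (ENNReal.ofReal_pos.2 hApos).ne' ENNReal.ofReal_ne_top).1 hD

lemma ode_measure {N : ℕ} (S : Set (E N)) (hS : MeasurableSet S) (hSf : volume S ≠ ⊤)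
    (t₀ ρ C1 Q : ℝ) (hρ : 0 < ρ) (hC1 : 0 ≤ C1) (hQ : 0 < Q) (w : E N → ℝ → ℝ)
    (hw : Measurable (fun p : E N × ℝ => w p.1 p.2)) (V V' : ℝ → ℝ)
    (hV : ∀ t ∈ Ico t₀ (t₀ + ρ), HasDerivAt V (V' t) t)
    (hpos : ∀ t ∈ Ico t₀ (t₀ + ρ), 0 ≤ V' t + C1 / ρ)
    (hP : ∀ t ∈ Ico t₀ (t₀ + ρ), ∫⁻ x in S, ENNReal.ofReal ((w x t - V t) ^ 2) ≤
      ENNReal.ofReal (Q * (V' t + C1 / ρ)))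
    (lam : ℝ) (hlam : 0 < lam) :
    volume {p : E N × ℝ | p ∈ S ×ˢ Ioo t₀ (t₀ + ρ) ∧ w p.1 p.2 < V t₀ - lam - C1} ≤
      ENNReal.ofReal (Q / lam) := by
  set f : ℝ → ℝ := fun t => lam + (V t - V t₀) + C1 / ρ * (t - t₀) with hf
  have hfd : ∀ t ∈ Ico t₀ (t₀ + ρ), HasDerivAt f (V' t + C1 / ρ) t := by
    intro t ht
    have h1 := ((hV t ht).sub_const (V t₀)).const_add lam
    have h2 := ((hasDerivAt_id t).sub_const t₀).const_mul (C1 / ρ)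
    have h3 := h1.add h2
    rw [mul_one] at h3
    exact h3
  have hft0 : f t₀ = lam := by simp [f]
  have hmono : ∀ b ∈ Ico t₀ (t₀ + ρ), lam ≤ f b := by
    intro b hb
    have hsub : Icc t₀ b ⊆ Ico t₀ (t₀ + ρ) := fun t ht => ⟨ht.1, ht.2.trans_lt hb.2⟩
    have hm : MonotoneOn f (Icc t₀ b) := by
      apply monotoneOn_of_deriv_nonneg (convex_Icc _ _)
      · exact fun t ht => (hfd t (hsub ht)).continuousAt.continuousWithinAt
      · intro t ht
        exact (hfd t (hsub (interior_subset ht))).differentiableAt.differentiableWithinAt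
      · intro t ht
        rw [(hfd t (hsub (interior_subset ht))).deriv]
        exact hpos t (hsub (interior_subset ht))
    rw [← hft0]
    exact hm ⟨le_rfl, hb.1⟩ ⟨hb.1, le_rfl⟩ hb.1
  set Z : Set (E N × ℝ) := {p | p.1 ∈ S ∧ w p.1 p.2 < V t₀ - lam - C1} with hZ
  have hZm : MeasurableSet Z :=
    (measurable_fst hS).inter (measurableSet_lt hw measurable_const)
  set M : ℝ → ℝ≥0∞ := fun t => volume ((fun x => (x, t)) ⁻¹' Z) with hM
  have hMm : Measurable M := measurable_measure_prodMk_right hZm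
  have hMle : ∀ t, M t ≤ volume S := fun t => measure_mono fun x hx => hx.1
  have hMfin : ∀ t, M t ≠ ⊤ := fun t => ((hMle t).trans_lt hSf.lt_top).ne
  have hkey : ∀ t ∈ Ico t₀ (t₀ + ρ), (M t).toReal / Q ≤ (V' t + C1 / ρ) / f t ^ 2 := by
    intro t ht
    have hfp : 0 < f t := hlam.trans_le (hmono t ht)
    have h1 : M t * ENNReal.ofReal (f t ^ 2) ≤ ENNReal.ofReal (Q * (V' t + C1 / ρ)) := by
      refine le_trans ?_ (hP t ht)
      have hsl : MeasurableSet ((fun x => (x, t)) ⁻¹' Z) := measurable_prodMk_right hZm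
      calc M t * ENNReal.ofReal (f t ^ 2)
          = ∫⁻ x in ((fun x => (x, t)) ⁻¹' Z), ENNReal.ofReal (f t ^ 2) := by
            rw [setLIntegral_const, mul_comm]
        _ ≤ ∫⁻ x in ((fun x => (x, t)) ⁻¹' Z), ENNReal.ofReal ((w x t - V t) ^ 2) := by
            apply setLIntegral_mono' hsl
            intro x hx
            apply ENNReal.ofReal_le_ofReal
            have hx2 : w x t < V t₀ - lam - C1 := hx.2
            have h3 : C1 / ρ * (t - t₀) ≤ C1 := by
              calc C1 / ρ * (t - t₀) ≤ C1 / ρ * ρ := by gcongr; linarith [ht.2]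
                _ = C1 := by field_simp
            have h4 : f t ≤ V t - w x t := by simp only [f]; linarith
            have : (w x t - V t) ^ 2 = (V t - w x t) ^ 2 := by ring
            rw [this]; gcongr
        _ ≤ _ := lintegral_mono_set fun x hx => hx.1
    have h2 : (M t).toReal * f t ^ 2 ≤ Q * (V' t + C1 / ρ) := by
      have := ENNReal.toReal_mono ENNReal.ofReal_ne_top h1
      rwa [ENNReal.toReal_mul, ENNReal.toReal_ofReal (by positivity),
        ENNReal.toReal_ofReal (mul_nonneg hQ.le (hpos t ht))] at this
    rw [div_le_div_iff₀ hQ (by positivity)]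
    linarith
  have hb : ∀ b ∈ Ico t₀ (t₀ + ρ), volume (Z ∩ {p | p.2 ∈ Ioc t₀ b}) ≤ ENNReal.ofReal (Q / lam) := by
    intro b hb
    have hsub : Icc t₀ b ⊆ Ico t₀ (t₀ + ρ) := fun t ht => ⟨ht.1, ht.2.trans_lt hb.2⟩
    have hgd : ∀ t ∈ Icc t₀ b, HasDerivAt (fun t => -(f t)⁻¹) ((V' t + C1 / ρ) / f t ^ 2) t := by
      intro t ht
      have := ((hfd t (hsub ht)).inv (hlam.trans_le (hmono t (hsub ht))).ne').neg
      rw [neg_div, neg_neg] at this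
      exact this
    have hint : IntegrableOn (fun t => (M t).toReal / Q) (Icc t₀ b) := by
      apply Measure.integrableOn_of_bounded (M := (volume S).toReal / Q) (by simp)
      · exact (hMm.ennreal_toReal.div_const Q).aestronglyMeasurable
      · refine Filter.Eventually.of_forall fun t => ?_
        rw [Real.norm_of_nonneg (by positivity)]
        have := ENNReal.toReal_mono hSf (hMle t)
        gcongr
    have hI := intervalIntegral.integral_le_sub_of_hasDeriv_right_of_le hb.1
      (fun t ht => (hgd t ht).continuousAt.continuousWithinAt)
      (fun t ht => (hgd t (Ioo_subset_Icc_self ht)).hasDerivWithinAt) hint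
      (fun t ht => hkey t (hsub (Ioo_subset_Icc_self ht)))
    rw [hft0, intervalIntegral.integral_of_le hb.1] at hI
    have hfb : 0 < (f b)⁻¹ := inv_pos.2 (hlam.trans_le (hmono b hb))
    have hI2 : ∫ t in Ioc t₀ b, (M t).toReal / Q ≤ lam⁻¹ := by linarith
    rw [integral_div, div_le_iff₀ hQ] at hI2
    have hMi : IntegrableOn (fun t => (M t).toReal) (Ioc t₀ b) := by
      have := (hint.mono_set Ioc_subset_Icc_self).mul_const Q
      refine this.congr (Filter.Eventually.of_forall fun t => ?_)
      simp only []
      field_simp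
    calc volume (Z ∩ {p | p.2 ∈ Ioc t₀ b}) = ∫⁻ t in Ioc t₀ b, M t := by
          have hm2 : MeasurableSet (Z ∩ {p : E N × ℝ | p.2 ∈ Ioc t₀ b}) :=
            hZm.inter (measurable_snd measurableSet_Ioc)
          rw [Measure.volume_eq_prod, Measure.prod_apply_symm hm2,
            ← lintegral_indicator measurableSet_Ioc]
          congr 1; ext t
          by_cases ht : t ∈ Ioc t₀ b
          · rw [indicator_of_mem ht]
            congr 1; ext x; simp only [mem_preimage, mem_inter_iff, mem_setOf_eq]; tauto
          · rw [indicator_of_notMem ht]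
            convert measure_empty (μ := (volume : Measure (E N)))
            ext x; simp only [mem_preimage, mem_inter_iff, mem_setOf_eq, mem_empty_iff_false]; tauto
      _ = ∫⁻ t in Ioc t₀ b, ENNReal.ofReal (M t).toReal := by
          simp_rw [ENNReal.ofReal_toReal (hMfin _)]
      _ = ENNReal.ofReal (∫ t in Ioc t₀ b, (M t).toReal) := by
          rw [ofReal_integral_eq_lintegral_ofReal hMi]
          exact Filter.Eventually.of_forall fun t => ENNReal.toReal_nonneg
      _ ≤ _ := by
          apply ENNReal.ofReal_le_ofReal
          rw [div_eq_inv_mul]; exact hI2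
  set bn : ℕ → ℝ := fun n => t₀ + ρ - ρ / (n + 1) with hbn
  have hbnm : Monotone bn := by
    intro m n hmn
    simp only [bn]
    gcongr
  have hbmem : ∀ n, bn n ∈ Ico t₀ (t₀ + ρ) := by
    intro n
    have h1 : ρ / (n + 1) ≤ ρ := div_le_self hρ.le (by linarith [n.cast_nonneg (α := ℝ)])
    have h2 : 0 < ρ / ((n : ℝ) + 1) := by positivity
    constructor <;> simp only [bn] <;> linarith
  have hU : {p : E N × ℝ | p ∈ S ×ˢ Ioo t₀ (t₀ + ρ) ∧ w p.1 p.2 < V t₀ - lam - C1} ⊆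
      ⋃ n, (Z ∩ {p | p.2 ∈ Ioc t₀ (bn n)}) := by
    rintro ⟨x, t⟩ ⟨⟨hx, ht⟩, hlt⟩
    simp only at hx ht hlt
    rw [mem_iUnion]
    have : 0 < t₀ + ρ - t := by linarith [ht.2]
    obtain ⟨n, hn⟩ := exists_nat_gt (ρ / (t₀ + ρ - t))
    refine ⟨n, ⟨hx, hlt⟩, ht.1, ?_⟩
    simp only [bn]
    have : ρ / (n + 1) ≤ t₀ + ρ - t := by
      rw [div_le_iff₀ (by positivity)]
      rw [div_lt_iff₀ this] at hn
      nlinarith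
    linarith
  refine (measure_mono hU).trans ?_
  rw [Monotone.measure_iUnion]
  · exact iSup_le fun n => hb _ (hbmem n)
  · intro m n hmn p hp
    exact ⟨hp.1, hp.2.1, hp.2.2.trans (hbnm hmn)⟩

lemma J_integrable {N : ℕ} (hN : 2 ≤ N) {s c : ℝ} (hs : s ∈ Ioo (0:ℝ) 1) (hc : 0 < c) :
    Integrable (fun z : E N => min (c ^ 2 * ‖z‖ ^ 2) 1 * ‖z‖ ^ (-((N : ℝ) + 2 * s))) := by
  have : Nonempty (Fin N) := ⟨⟨0, by omega⟩⟩
  have : Nontrivial (E N) := inferInstance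
  obtain ⟨hs0, hs1⟩ := hs
  rw [integrable_fun_norm_addHaar volume
    (f := fun y : ℝ => min (c ^ 2 * y ^ 2) 1 * y ^ (-((N : ℝ) + 2 * s)))]
  rw [finrank_euclideanSpace_fin, ← Ioc_union_Ioi_eq_Ioi zero_le_one]
  have hcast : ((N - 1 : ℕ) : ℝ) = (N : ℝ) - 1 := by
    rw [Nat.cast_sub (by omega)]; simp
  have hmeas : Measurable (fun y : ℝ => y ^ (N - 1) • (min (c ^ 2 * y ^ 2) 1 * y ^ (-((N : ℝ) + 2 * s)))) := by
    simp only [smul_eq_mul]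
    fun_prop
  have hpow : ∀ y : ℝ, 0 < y → y ^ (N - 1) * y ^ (-((N : ℝ) + 2 * s)) = y ^ (-1 - 2 * s) := by
    intro y hy
    rw [← Real.rpow_natCast, ← Real.rpow_add hy, hcast]; congr 1; ring
  refine IntegrableOn.union ?_ ?_
  · have h1 : IntegrableOn (fun y : ℝ => c ^ 2 * y ^ (1 - 2 * s)) (Ioc 0 1) := by
      have := intervalIntegral.intervalIntegrable_rpow' (a := 0) (b := 1) (r := 1 - 2 * s) (by linarith)
      rw [intervalIntegrable_iff_integrableOn_Ioc_of_le zero_le_one] at this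
      exact this.const_mul _
    refine Integrable.mono' h1 hmeas.aestronglyMeasurable ?_
    refine (ae_restrict_iff' measurableSet_Ioc).2 (Filter.Eventually.of_forall fun y hy => ?_)
    have hy0 : 0 < y := hy.1
    rw [Real.norm_of_nonneg (by simp only [smul_eq_mul]; positivity), smul_eq_mul]
    calc y ^ (N - 1) * (min (c ^ 2 * y ^ 2) 1 * y ^ (-((N : ℝ) + 2 * s)))
        ≤ y ^ (N - 1) * ((c ^ 2 * y ^ 2) * y ^ (-((N : ℝ) + 2 * s))) := by
          gcongr; exact min_le_left _ _
      _ = c ^ 2 * (y ^ (2:ℝ) * (y ^ (N - 1) * y ^ (-((N : ℝ) + 2 * s)))) := by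
          rw [Real.rpow_two]; ring
      _ = _ := by rw [hpow y hy0, ← Real.rpow_add hy0]; congr 2; ring
  · have h1 : IntegrableOn (fun y : ℝ => y ^ (-1 - 2 * s)) (Ioi 1) :=
      integrableOn_Ioi_rpow_of_lt (by linarith) one_pos
    refine Integrable.mono' h1 hmeas.aestronglyMeasurable ?_
    refine (ae_restrict_iff' measurableSet_Ioi).2 (Filter.Eventually.of_forall fun y hy => ?_)
    have hy0 : 0 < y := one_pos.trans hy
    rw [Real.norm_of_nonneg (by simp only [smul_eq_mul]; positivity), smul_eq_mul]
    calc y ^ (N - 1) * (min (c ^ 2 * y ^ 2) 1 * y ^ (-((N : ℝ) + 2 * s)))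
        ≤ y ^ (N - 1) * (1 * y ^ (-((N : ℝ) + 2 * s))) := by
          gcongr; exact min_le_right _ _
      _ = _ := by rw [one_mul, hpow y hy0]

lemma tail_lemma {N : ℕ} (hN : 2 ≤ N) {s : ℝ} (hs : s ∈ Ioo (0:ℝ) 1) (u : E N → ℝ → ℝ)
    (hu : Measurable (fun p : E N × ℝ => u p.1 p.2)) (M : ℝ) (t₁ t₂ : ℝ) (ht : t₁ < t₂)
    (hM : ∀ x t, t ∈ Ioo t₁ t₂ → |u x t| ≤ M) (x₀ : E N) {R r d l : ℝ} (hR : 0 < R)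
    (hl : l = (r / R) ^ 2 * tailInfty N s (uminus N u) x₀ R t₁ t₂ + d) :
    ∃ σ : ℝ, 0 ≤ σ ∧ l = r ^ 2 * σ + d ∧ ∀ᵐ t ∂(volume.restrict (Ioo t₁ t₂)),
      ∫⁻ y in (ball x₀ R)ᶜ, ENNReal.ofReal (uminus N u y t * ‖y - x₀‖ ^ (-((N : ℝ) + 2 * s))) ≤
        ENNReal.ofReal σ := by
  set a : ℝ → ℝ := fun t => ∫ y in (ball x₀ R)ᶜ, |uminus N u y t| * ‖y - x₀‖ ^ (-((N : ℝ) + 2 * s)) with ha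
  set σ := essSup a (volume.restrict (Ioo t₁ t₂)) with hσ
  have hk : IntegrableOn (fun y : E N => ‖y - x₀‖ ^ (-((N : ℝ) + 2 * s))) (ball x₀ R)ᶜ := by
    have h1 := ((J_integrable hN hs (inv_pos.2 hR)).comp_sub_right x₀).integrableOn (s := (ball x₀ R)ᶜ)
    refine h1.congr_fun (fun y hy => ?_) measurableSet_ball.compl
    have hy' : R ≤ ‖y - x₀‖ := by simpa [dist_eq_norm] using hy
    have : 1 ≤ (R⁻¹) ^ 2 * ‖y - x₀‖ ^ 2 := by
      rw [← mul_pow]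
      apply one_le_pow₀
      rw [inv_mul_eq_div, one_le_div hR]; exact hy'
    simp only []
    rw [min_eq_right this, one_mul]
  have hnn : ∀ y t, 0 ≤ uminus N u y t := fun y t => le_max_right _ _
  have hub : ∀ y, ∀ t ∈ Ioo t₁ t₂, uminus N u y t ≤ |M| := by
    intro y t ht
    have := hM y t ht
    refine max_le ?_ (abs_nonneg _)
    exact (neg_le_abs _).trans (this.trans (le_abs_self _))
  have hmeas : ∀ t, Measurable (fun y => uminus N u y t) := by
    intro t
    have : Measurable (fun y => u y t) := hu.comp measurable_prodMk_right
    exact (this.neg).max measurable_const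
  have hint : ∀ t ∈ Ioo t₁ t₂, IntegrableOn
      (fun y => |uminus N u y t| * ‖y - x₀‖ ^ (-((N : ℝ) + 2 * s))) (ball x₀ R)ᶜ := by
    intro t ht
    refine Integrable.mono' (hk.const_mul |M|) ?_ (Filter.Eventually.of_forall fun y => ?_)
    · refine Measurable.aestronglyMeasurable ?_
      have := hmeas t
      fun_prop
    · rw [Real.norm_of_nonneg (by positivity), abs_of_nonneg (hnn y t)]
      have := hub y t ht
      gcongr
  have hμ : (volume.restrict (Ioo t₁ t₂)) ≠ 0 := by
    rw [Ne, Measure.restrict_eq_zero, Real.volume_Ioo]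
    simp; exact ht
  have hbd : Filter.IsBoundedUnder (· ≤ ·) (ae (volume.restrict (Ioo t₁ t₂))) a := by
    refine ⟨∫ y in (ball x₀ R)ᶜ, |M| * ‖y - x₀‖ ^ (-((N : ℝ) + 2 * s)), ?_⟩
    rw [Filter.eventually_map]
    refine (ae_restrict_iff' measurableSet_Ioo).2 (Filter.Eventually.of_forall fun t ht => ?_)
    refine integral_mono (hint t ht) (hk.const_mul _) fun y => ?_
    simp only [abs_of_nonneg (hnn y t)]
    have := hub y t ht
    gcongr
  have hle : ∀ᵐ t ∂(volume.restrict (Ioo t₁ t₂)), a t ≤ σ := ae_le_essSup hbd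
  have ha0 : ∀ t, 0 ≤ a t := fun t => integral_nonneg fun y => by positivity
  have hσ0 : 0 ≤ σ := by
    have : (ae (volume.restrict (Ioo t₁ t₂))).NeBot := ae_neBot.2 hμ
    obtain ⟨t, ht⟩ := hle.exists
    exact (ha0 t).trans ht
  refine ⟨σ, hσ0, ?_, ?_⟩
  · rw [hl, tailInfty, ← hσ]; field_simp
  · filter_upwards [hle, ae_restrict_mem measurableSet_Ioo] with t h1 h2
    have : ∫⁻ y in (ball x₀ R)ᶜ, ENNReal.ofReal (uminus N u y t * ‖y - x₀‖ ^ (-((N : ℝ) + 2 * s))) =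
        ENNReal.ofReal (a t) := by
      rw [ha, ofReal_integral_eq_lintegral_ofReal (hint t h2)
        (Filter.Eventually.of_forall fun y => by positivity)]
      simp_rw [abs_of_nonneg (hnn _ t)]
    rw [this]
    exact ENNReal.ofReal_le_ofReal h1

lemma alg1 {A B p q : ℝ} (hA : 0 < A) (hB : 0 < B) :
    (A - B) * (p ^ 2 / A - q ^ 2 / B) ≤ (p - q) ^ 2 := by
  have : (p - q) ^ 2 - (A - B) * (p ^ 2 / A - q ^ 2 / B) = (p * B - q * A) ^ 2 / (A * B) := by
    field_simp; ring
  have h2 : 0 ≤ (p * B - q * A) ^ 2 / (A * B) := by positivity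
  linarith

lemma nonlocal_bound {N : ℕ} {s Λ C₀ M₀ σ : ℝ} (hs : s ∈ Ioo (0:ℝ) 1)
    (hΛ : 1 ≤ Λ) (hC₀ : 0 < C₀) (hM₀ : 0 ≤ M₀)
    (hJ : ∫⁻ z : E N, ENNReal.ofReal (min (C₀ ^ 2 * ‖z‖ ^ 2) 1 * ‖z‖ ^ (-((N : ℝ) + 2 * s))) ≤
      ENNReal.ofReal M₀)
    (x₀ : E N) {r R l : ℝ} (hr : 0 < r) (hr1 : r ≤ 1) (hrR : r < R / 2) (hl : 0 < l)
    (hσ : 0 ≤ σ) (hlσ : r ^ 2 * σ ≤ l) (a : E N → ℝ) (ham : Measurable a)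
    (ha : ∀ x ∈ ball x₀ R, 0 ≤ a x)
    (htail : ∫⁻ y in (ball x₀ R)ᶜ, ENNReal.ofReal (max (-a y) 0 * ‖y - x₀‖ ^ (-((N : ℝ) + 2 * s))) ≤
        ENNReal.ofReal σ)
    (k : E N → E N → ℝ) (hks : ∀ x y, k x y = k y x)
    (hk : ∀ x y : E N, x ≠ y → Λ⁻¹ * ‖x - y‖ ^ (-((N : ℝ) + 2 * s)) ≤ k x y ∧
      k x y ≤ Λ * ‖x - y‖ ^ (-((N : ℝ) + 2 * s)))
    (ψ : E N → ℝ) (h0 : ∀ x, 0 ≤ ψ x) (h1 : ∀ x, ψ x ≤ 1)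
    (hz : ∀ x, x ∉ ball x₀ (3 * r / 2) → ψ x = 0)
    (hlip : ∀ x y, |ψ x - ψ y| ≤ C₀ / r * ‖x - y‖) (χ : ℝ) (hχ : 0 ≤ χ) :
    ∫ x, ∫ y, (a x - a y) * (ψ x ^ 2 * χ / (a x + l) - ψ y ^ 2 * χ / (a y + l)) * k x y ≤
      χ * (2 * (Λ * M₀ + Λ * 4 ^ ((N : ℝ) + 2 * s)) / r ^ 2 *
        (volume (ball x₀ (3 * r / 2))).toReal) := by
  classical
  set p := (N : ℝ) + 2 * s with hp
  have hp0 : 0 < p := by have := hs.1; have : (0:ℝ) ≤ N := N.cast_nonneg; linarith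
  set B := ball x₀ (3 * r / 2) with hB
  set D := ball x₀ R with hD
  have hBD : B ⊆ D := ball_subset_ball (by linarith)
  have hΛ0 : 0 < Λ := by linarith
  set β1 : E N → E N → ℝ := fun x y => χ * (Λ / r ^ 2) * (min (C₀ ^ 2 * ‖x - y‖ ^ 2) 1 * ‖x - y‖ ^ (-p)) with hβ1
  set β2 : E N → ℝ := fun y => χ * (Λ * 4 ^ p / l) * (max (-a y) 0 * ‖y - x₀‖ ^ (-p)) with hβ2
  set β2' : E N → ℝ≥0∞ := Dᶜ.indicator (fun y => ENNReal.ofReal (β2 y)) with hβ2'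
  set F : E N → E N → ℝ := fun x y =>
    (a x - a y) * (ψ x ^ 2 * χ / (a x + l) - ψ y ^ 2 * χ / (a y + l)) * k x y with hF
  have hβ1n : ∀ x y, 0 ≤ β1 x y := fun x y => by
    simp only [hβ1]; positivity
  have hβ2n : ∀ y, 0 ≤ β2 y := fun y => by
    simp only [hβ2]
    have := le_max_right (-a y) 0
    positivity
  have hmin : ∀ x y, (ψ x - ψ y) ^ 2 ≤ (1 / r ^ 2) * min (C₀ ^ 2 * ‖x - y‖ ^ 2) 1 := by
    intro x y
    rw [mul_min_of_nonneg _ _ (by positivity)]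
    refine le_min ?_ ?_
    · rw [← sq_abs]
      calc |ψ x - ψ y| ^ 2 ≤ (C₀ / r * ‖x - y‖) ^ 2 := by gcongr; exact hlip x y
        _ = _ := by field_simp
    · have e1 : (ψ x - ψ y) ^ 2 ≤ 1 := by
        rw [sq_le_one_iff_abs_le_one, abs_le]
        constructor <;> linarith [h0 x, h0 y, h1 x, h1 y]
      have e2 : 1 ≤ 1 / r ^ 2 := by
        rw [one_le_div (by positivity)]; exact pow_le_one₀ hr.le hr1
      linarith
  have hkn : ∀ x y, x ≠ y → 0 ≤ k x y := fun x y hxy => le_trans (by positivity) (hk x y hxy).1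
  have hpw : ∀ x ∈ B, ∀ y, ENNReal.ofReal (F x y) ≤ ENNReal.ofReal (β1 x y) + β2' y := by
    intro x hx y
    by_cases hxy : x = y
    · subst hxy; simp [hF]
    have hxD := hBD hx
    have hvx : 0 < a x + l := by linarith [ha x hxD]
    have hkxy := hkn x y hxy
    have hkey1 : ∀ q : ℝ, q ≤ (ψ x - ψ y) ^ 2 → χ * q * k x y ≤ β1 x y := by
      intro q hq
      calc χ * q * k x y ≤ χ * ((1 / r ^ 2) * min (C₀ ^ 2 * ‖x - y‖ ^ 2) 1) * (Λ * ‖x - y‖ ^ (-p)) := by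
            have e1 : χ * q ≤ χ * ((1 / r ^ 2) * min (C₀ ^ 2 * ‖x - y‖ ^ 2) 1) :=
              mul_le_mul_of_nonneg_left (hq.trans (hmin x y)) hχ
            exact mul_le_mul e1 (hk x y hxy).2 hkxy (by positivity)
        _ = β1 x y := by simp only [hβ1]; ring
    by_cases hyD : y ∈ D
    · have hvy : 0 < a y + l := by linarith [ha y hyD]
      refine le_trans (ENNReal.ofReal_le_ofReal ?_) le_self_add
      have hFe : F x y = χ * (((a x + l) - (a y + l)) * (ψ x ^ 2 / (a x + l) - ψ y ^ 2 / (a y + l))) * k x y := by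
        simp only [hF]; ring
      rw [hFe]
      exact hkey1 _ (alg1 hvx hvy)
    · have hψy : ψ y = 0 := hz y (fun h => hyD (hBD h))
      have hin : β2' y = ENNReal.ofReal (β2 y) := indicator_of_mem (s := Dᶜ) hyD _
      rw [hin, ← ENNReal.ofReal_add (hβ1n x y) (hβ2n y)]
      apply ENNReal.ofReal_le_ofReal
      have hFe : F x y = χ * (ψ x ^ 2 * (1 - (a y + l) / (a x + l))) * k x y := by
        simp only [hF, hψy]; field_simp; ring
      have hq : 1 - (a y + l) / (a x + l) ≤ 1 + max (-a y) 0 / l := by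
        have e1 : -(a y + l) ≤ max (-a y) 0 := by linarith [le_max_left (-a y) 0]
        have e2 : -(a y + l) / (a x + l) ≤ max (-a y) 0 / (a x + l) := by gcongr
        have e3 : max (-a y) 0 / (a x + l) ≤ max (-a y) 0 / l := by
          apply div_le_div_of_nonneg_left (le_max_right _ _) hl
          linarith [ha x hxD]
        rw [neg_div] at e2
        linarith
      have hψx1 : ψ x ^ 2 ≤ 1 := pow_le_one₀ (h0 x) (h1 x)
      have hmx : 0 ≤ max (-a y) 0 := le_max_right _ _
      have hdist : ‖y - x₀‖ / 4 ≤ ‖x - y‖ := by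
        have e1 : ‖x - x₀‖ < 3 * r / 2 := by rw [← dist_eq_norm]; exact hx
        have e2 : R ≤ ‖y - x₀‖ := by
          rw [← dist_eq_norm]; simpa [hD] using hyD
        have e3 : ‖y - x₀‖ ≤ ‖x - y‖ + ‖x - x₀‖ := by
          have := norm_sub_le_norm_sub_add_norm_sub y x x₀
          rwa [norm_sub_rev y x] at this
        linarith
      have hy0 : 0 < ‖y - x₀‖ := by
        have e2 : R ≤ ‖y - x₀‖ := by
          rw [← dist_eq_norm]; simpa [hD] using hyD
        linarith
      have hkk : k x y ≤ Λ * 4 ^ p * ‖y - x₀‖ ^ (-p) := by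
        refine (hk x y hxy).2.trans ?_
        rw [mul_assoc]
        gcongr
        calc ‖x - y‖ ^ (-p) ≤ (‖y - x₀‖ / 4) ^ (-p) :=
              Real.rpow_le_rpow_of_nonpos (by positivity) hdist (by linarith)
          _ = 4 ^ p * ‖y - x₀‖ ^ (-p) := by
              rw [Real.div_rpow hy0.le (by norm_num), Real.rpow_neg (by norm_num : (0:ℝ) ≤ 4)]
              field_simp
      calc F x y = χ * (ψ x ^ 2 * (1 - (a y + l) / (a x + l))) * k x y := hFe
        _ ≤ χ * (ψ x ^ 2 * (1 + max (-a y) 0 / l)) * k x y := by gcongr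
        _ = χ * ψ x ^ 2 * k x y + χ * (ψ x ^ 2 * (max (-a y) 0 / l)) * k x y := by ring
        _ ≤ β1 x y + χ * (1 * (max (-a y) 0 / l)) * (Λ * 4 ^ p * ‖y - x₀‖ ^ (-p)) := by
            apply add_le_add
            · exact hkey1 _ (by rw [hψy]; simp)
            · gcongr
        _ = β1 x y + β2 y := by simp only [hβ2]; ring
  have hFsymm : ∀ x y, F x y = F y x := by
    intro x y; simp only [hF]; rw [hks x y]; ring
  set b : E N → E N → ℝ≥0∞ := fun x y => B.indicator (fun _ => ENNReal.ofReal (β1 x y) + β2' y) x with hb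
  have hbF : ∀ x y, ENNReal.ofReal (F x y) ≤ b x y + b y x := by
    intro x y
    by_cases hx : x ∈ B
    · refine le_trans ?_ le_self_add
      simp only [hb, indicator_of_mem hx]
      exact hpw x hx y
    · by_cases hy : y ∈ B
      · refine le_trans ?_ le_add_self
        simp only [hb, indicator_of_mem hy]
        rw [hFsymm]
        exact hpw y hy x
      · have : F x y = 0 := by simp [hF, hz x hx, hz y hy]
        simp [this]
  have hb1m : Measurable (fun q : E N × E N => ENNReal.ofReal (β1 q.1 q.2)) := by
    simp only [hβ1]
    fun_prop
  have hb2m : Measurable β2' := by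
    refine Measurable.indicator ?_ measurableSet_ball.compl
    simp only [hβ2]
    fun_prop
  have hbm : Measurable (fun q : E N × E N => b q.1 q.2) := by
    have : (fun q : E N × E N => b q.1 q.2) = (Prod.fst ⁻¹' B).indicator
        (fun q => ENNReal.ofReal (β1 q.1 q.2) + β2' q.2) := by
      ext q; simp only [hb, indicator, mem_preimage]
    rw [this]
    exact (hb1m.add (hb2m.comp measurable_snd)).indicator (measurable_fst measurableSet_ball)
  have hI1 : ∀ x, ∫⁻ y, ENNReal.ofReal (β1 x y) ≤ ENNReal.ofReal (χ * (Λ / r ^ 2) * M₀) := by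
    intro x
    simp only [hβ1]
    simp_rw [ENNReal.ofReal_mul (by positivity : 0 ≤ χ * (Λ / r ^ 2))]
    rw [lintegral_const_mul' _ _ ENNReal.ofReal_ne_top]
    gcongr
    refine le_trans (le_of_eq ?_) hJ
    exact lintegral_sub_left_eq_self (fun z : E N => ENNReal.ofReal (min (C₀ ^ 2 * ‖z‖ ^ 2) 1 * ‖z‖ ^ (-p))) x
  have hI2 : ∫⁻ y, β2' y ≤ ENNReal.ofReal (χ * (Λ * 4 ^ p / r ^ 2)) := by
    rw [hβ2', lintegral_indicator measurableSet_ball.compl]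
    simp only [hβ2]
    simp_rw [ENNReal.ofReal_mul (by positivity : 0 ≤ χ * (Λ * 4 ^ p / l))]
    rw [lintegral_const_mul' _ _ ENNReal.ofReal_ne_top]
    refine (mul_le_mul_right htail _).trans ?_
    rw [← ENNReal.ofReal_mul (by positivity)]
    apply ENNReal.ofReal_le_ofReal
    have : σ / l ≤ 1 / r ^ 2 := by
      rw [div_le_div_iff₀ hl (by positivity)]; linarith
    calc χ * (Λ * 4 ^ p / l) * σ = χ * (Λ * 4 ^ p) * (σ / l) := by ring
      _ ≤ χ * (Λ * 4 ^ p) * (1 / r ^ 2) := by gcongr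
      _ = _ := by ring
  have hbI : ∫⁻ x, ∫⁻ y, b x y ≤ ENNReal.ofReal (χ * ((Λ * M₀ + Λ * 4 ^ p) / r ^ 2)) * volume B := by
    have : ∀ x, ∫⁻ y, b x y ≤ B.indicator (fun _ => ENNReal.ofReal (χ * ((Λ * M₀ + Λ * 4 ^ p) / r ^ 2))) x := by
      intro x
      by_cases hx : x ∈ B
      · simp only [hb, indicator_of_mem hx]
        rw [lintegral_add_right _ hb2m]
        refine (add_le_add (hI1 x) hI2).trans ?_
        rw [← ENNReal.ofReal_add (by positivity) (by positivity)]
        apply ENNReal.ofReal_le_ofReal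
        apply le_of_eq; ring
      · simp [hb, indicator_of_notMem hx]
    refine (lintegral_mono this).trans ?_
    rw [lintegral_indicator measurableSet_ball, setLIntegral_const]
  have hfin : volume B ≠ ⊤ := measure_ball_lt_top.ne
  apply aux_integral_le _ (by positivity)
  calc ∫⁻ x, ENNReal.ofReal (∫ y, F x y) ≤ ∫⁻ x, ∫⁻ y, ENNReal.ofReal (F x y) :=
        lintegral_mono fun x => aux_ofReal_integral_le _
    _ ≤ ∫⁻ x, ∫⁻ y, (b x y + b y x) := lintegral_mono fun x => lintegral_mono fun y => hbF x y
    _ = ∫⁻ x, ((∫⁻ y, b x y) + ∫⁻ y, b y x) := by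
        congr 1; ext x
        exact lintegral_add_left (hbm.comp measurable_prodMk_left) _
    _ = (∫⁻ x, ∫⁻ y, b x y) + ∫⁻ x, ∫⁻ y, b y x :=
        lintegral_add_left (Measurable.lintegral_prod_right' hbm) _
    _ = (∫⁻ x, ∫⁻ y, b x y) + ∫⁻ x, ∫⁻ y, b x y := by
        congr 1
        exact lintegral_lintegral_swap (f := fun x y => b y x) (hbm.comp measurable_swap).aemeasurable
    _ ≤ _ := add_le_add hbI hbI
    _ = _ := by
        have e : volume B = ENNReal.ofReal (volume B).toReal := (ENNReal.ofReal_toReal hfin).symm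
        have e2 : ENNReal.ofReal (χ * ((Λ * M₀ + Λ * 4 ^ p) / r ^ 2)) * volume B =
            ENNReal.ofReal (χ * ((Λ * M₀ + Λ * 4 ^ p) / r ^ 2) * (volume B).toReal) := by
          rw [ENNReal.ofReal_mul (q := (volume B).toReal) (by positivity), ← e]
        rw [e2, ← ENNReal.ofReal_add (by positivity) (by positivity)]
        congr 1; ring

lemma param_deriv {N : ℕ} (h h' : ℝ → E N → ℝ) (I : Set ℝ) (hI : IsOpen I) (k : Set (E N))
    (hk : IsCompact k)
    (hc : ContinuousOn (Function.uncurry h) (I ×ˢ univ))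
    (hc' : ContinuousOn (Function.uncurry h') (I ×ˢ univ))
    (hz : ∀ t ∈ I, ∀ x, x ∉ k → h t x = 0) (hz' : ∀ t ∈ I, ∀ x, x ∉ k → h' t x = 0)
    (hd : ∀ t ∈ I, ∀ x, HasDerivAt (fun τ => h τ x) (h' t x) t) (t : ℝ) (ht : t ∈ I) :
    HasDerivAt (fun τ => ∫ x, h τ x) (∫ x, h' t x) t := by
  obtain ⟨ε, hε, hεI⟩ := Metric.nhds_basis_closedBall.mem_iff.1 (hI.mem_nhds ht)
  have hsl : ∀ τ ∈ I, Continuous (h τ) := by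
    intro τ hτ
    rw [← continuousOn_univ]
    exact hc.comp (f := fun x : E N => (τ, x)) (by fun_prop) (fun x _ => ⟨hτ, mem_univ _⟩)
  have hsl' : ∀ τ ∈ I, Continuous (h' τ) := by
    intro τ hτ
    rw [← continuousOn_univ]
    exact hc'.comp (f := fun x : E N => (τ, x)) (by fun_prop) (fun x _ => ⟨hτ, mem_univ _⟩)
  have hcomp : IsCompact (closedBall t ε ×ˢ k) := (isCompact_closedBall t ε).prod hk
  obtain ⟨C, hC⟩ := hcomp.exists_bound_of_continuousOn
    (hc'.mono (prod_mono hεI (subset_univ _)))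
  have hkm : MeasurableSet k := hk.measurableSet
  have hint : Integrable (h t) :=
    (hsl t ht).integrable_of_hasCompactSupport (HasCompactSupport.intro hk (hz t ht))
  refine (hasDerivAt_integral_of_dominated_loc_of_deriv_le (s := closedBall t ε)
    (bound := k.indicator fun _ => C)
    (closedBall_mem_nhds t hε) ?_ hint (hsl' t ht).aestronglyMeasurable ?_ ?_ ?_).2
  · filter_upwards [hI.mem_nhds ht] with τ hτ using (hsl τ hτ).aestronglyMeasurable
  · refine Filter.Eventually.of_forall fun x τ hτ => ?_
    by_cases hx : x ∈ k
    · rw [indicator_of_mem hx]; exact hC (τ, x) ⟨hτ, hx⟩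
    · rw [indicator_of_notMem hx, hz' τ (hεI hτ) x hx]; simp
  · exact (integrable_indicator_iff hkm).2 (by
      apply integrableOn_const hk.measure_lt_top.ne)
  · exact Filter.Eventually.of_forall fun x τ hτ => hd τ (hεI hτ) x

lemma pos_of_test (Q : ℝ → ℝ) (c : ℝ) (I : Set ℝ) (hI : IsOpen I) (hQ : ContinuousOn Q I)
    (h : ∀ χ : ℝ → ℝ, ContDiff ℝ (⊤ : ℕ∞) χ → HasCompactSupport χ → tsupport χ ⊆ I →
      (∀ t, 0 ≤ χ t) → 0 ≤ ∫ t, χ t * (Q t + c)) : ∀ t ∈ I, 0 ≤ Q t + c := by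
  intro t ht
  by_contra hneg
  push Not at hneg
  have hQc : ContinuousAt (fun t => Q t + c) t := (hQ.continuousAt (hI.mem_nhds ht)).add continuousAt_const
  have hev : ∀ᶠ τ in nhds t, Q τ + c < 0 ∧ τ ∈ I :=
    (hQc.eventually (gt_mem_nhds hneg)).and (hI.mem_nhds ht)
  obtain ⟨χ, h1, h2, h3, h4, h5⟩ := exists_contDiff_tsupport_subset (n := ⊤) hev
  have hχ0 : ∀ τ, 0 ≤ χ τ := fun τ => (h4 (mem_range_self τ)).1
  have h6 := h χ h3 h2 (fun τ hτ => (h1 hτ).2) hχ0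
  have hcont : Continuous (fun τ => χ τ * (Q τ + c)) := by
    refine ContinuousOn.continuous_of_tsupport_subset (s := I) (h3.continuous.continuousOn.mul
      (hQ.add continuousOn_const)) hI ?_
    refine subset_trans ?_ (fun τ hτ => (h1 hτ).2)
    exact tsupport_mul_subset_left
  have hneg' : ∀ τ, 0 ≤ -(χ τ * (Q τ + c)) := by
    intro τ
    by_cases hτ : τ ∈ tsupport χ
    · have := (h1 hτ).1
      nlinarith [hχ0 τ]
    · simp [image_eq_zero_of_notMem_tsupport hτ]
  have hpos : 0 < ∫ τ, -(χ τ * (Q τ + c)) := by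
    refine Continuous.integral_pos_of_hasCompactSupport_nonneg_nonzero (x := t) hcont.neg ?_ hneg' ?_
    · refine h2.mono ?_
      intro τ hτ
      simp only [Function.mem_support] at hτ ⊢
      intro h0
      exact hτ (by rw [h0]; simp)
    · rw [h5]; simp; linarith
  rw [integral_neg] at hpos
  linarith

lemma loc_zero {N : ℕ} {ψ : E N → ℝ} {χ : ℝ → ℝ} (x : E N) (t : ℝ)
    (h : x ∉ tsupport ψ ∨ t ∉ tsupport χ) :
    ∀ᶠ p : E N × ℝ in nhds (x, t), ψ p.1 * χ p.2 = 0 := by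
  rcases h with h | h
  · have h1 : ∀ᶠ y in nhds x, ψ y = 0 := notMem_tsupport_iff_eventuallyEq.1 h
    filter_upwards [continuous_fst.continuousAt.eventually h1] with p hp
    simp [hp]
  · have h1 : ∀ᶠ y in nhds t, χ y = 0 := notMem_tsupport_iff_eventuallyEq.1 h
    filter_upwards [continuous_snd.continuousAt.eventually h1] with p hp
    simp [hp]

lemma ext_tsupport {N : ℕ} {ψ : E N → ℝ} {χ : ℝ → ℝ} (f : E N × ℝ → ℝ) :
    tsupport (fun p : E N × ℝ => ψ p.1 * χ p.2 * f p) ⊆ tsupport ψ ×ˢ tsupport χ := by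
  rintro ⟨x, t⟩ hp
  by_contra hn
  refine (notMem_tsupport_iff_eventuallyEq.2 ?_) hp
  have : x ∉ tsupport ψ ∨ t ∉ tsupport χ := by
    by_contra hh; push Not at hh; exact hn ⟨hh.1, hh.2⟩
  filter_upwards [loc_zero x t this] with p hp
  simp [hp]

lemma ext_compact {N : ℕ} {ψ : E N → ℝ} {χ : ℝ → ℝ} (hψ : HasCompactSupport ψ)
    (hχ : HasCompactSupport χ) (f : E N × ℝ → ℝ) :
    HasCompactSupport (fun p : E N × ℝ => ψ p.1 * χ p.2 * f p) :=
  HasCompactSupport.of_compactSpace_aux (hψ.isCompact.prod hχ.isCompact) (ext_tsupport f)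
where
  HasCompactSupport.of_compactSpace_aux {K : Set (E N × ℝ)} {g : E N × ℝ → ℝ} (hK : IsCompact K)
    (h : tsupport g ⊆ K) : HasCompactSupport g := hK.of_isClosed_subset (isClosed_tsupport g) h

lemma ext_contDiff {N : ℕ} {ψ : E N → ℝ} {χ : ℝ → ℝ} {O : Set (E N × ℝ)} (hO : IsOpen O)
    (hsub : tsupport ψ ×ˢ tsupport χ ⊆ O) (hψ : ContDiff ℝ (⊤ : ℕ∞) ψ)
    (hχ : ContDiff ℝ (⊤ : ℕ∞) χ) (f : E N × ℝ → ℝ) (hf : ContDiffOn ℝ (⊤ : ℕ∞) f O) :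
    ContDiff ℝ (⊤ : ℕ∞) (fun p : E N × ℝ => ψ p.1 * χ p.2 * f p) := by
  rw [contDiff_iff_contDiffAt]
  rintro ⟨x, t⟩
  by_cases h : x ∈ tsupport ψ ∧ t ∈ tsupport χ
  · have h1 : ContDiffAt ℝ (⊤ : ℕ∞) f (x, t) := hf.contDiffAt (hO.mem_nhds (hsub h))
    have h2 : ContDiff ℝ (⊤ : ℕ∞) (fun p : E N × ℝ => ψ p.1 * χ p.2) :=
      (hψ.comp contDiff_fst).mul (hχ.comp contDiff_snd)
    exact h2.contDiffAt.mul h1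
  · have h' : x ∉ tsupport ψ ∨ t ∉ tsupport χ := by tauto
    refine (contDiffAt_const (c := (0:ℝ))).congr_of_eventuallyEq ?_
    filter_upwards [loc_zero x t h'] with p hp
    simp [hp]

lemma ext_continuous {N : ℕ} {ψ : E N → ℝ} {χ : ℝ → ℝ} {O : Set (E N × ℝ)} (hO : IsOpen O)
    (hsub : tsupport ψ ×ˢ tsupport χ ⊆ O) (hψ : Continuous ψ)
    (hχ : Continuous χ) (f : E N × ℝ → ℝ) (hf : ContinuousOn f O) :
    Continuous (fun p : E N × ℝ => ψ p.1 * χ p.2 * f p) := by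
  refine ContinuousOn.continuous_of_tsupport_subset (s := O) ?_ hO ((ext_tsupport f).trans hsub)
  exact (by fun_prop : Continuous fun p : E N × ℝ => ψ p.1 * χ p.2).continuousOn.mul hf

lemma ext_continuousOn {N : ℕ} {ψ : E N → ℝ} {D : Set (E N)} {I : Set ℝ} (hD : IsOpen D)
    (hI : IsOpen I) (hsub : tsupport ψ ⊆ D) (hψ : Continuous ψ)
    (f : E N × ℝ → ℝ) (hf : ContinuousOn f (D ×ˢ I)) :
    ContinuousOn (Function.uncurry fun (t : ℝ) (x : E N) => ψ x * f (x, t)) (I ×ˢ univ) := by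
  rintro ⟨t, x⟩ ⟨ht, -⟩
  apply ContinuousAt.continuousWithinAt
  by_cases h : x ∈ tsupport ψ
  · have h1 : ContinuousAt f (x, t) := hf.continuousAt ((hD.prod hI).mem_nhds ⟨hsub h, ht⟩)
    have h2 : ContinuousAt (fun q : ℝ × E N => f (q.2, q.1)) (t, x) :=
      ContinuousAt.comp (f := fun q : ℝ × E N => (q.2, q.1)) h1 (by fun_prop)
    have h3 : ContinuousAt (fun q : ℝ × E N => ψ q.2) (t, x) := by fun_prop
    exact h3.mul h2
  · have h1 : ∀ᶠ y in nhds x, ψ y = 0 := notMem_tsupport_iff_eventuallyEq.1 h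
    have h2 : ∀ᶠ q : ℝ × E N in nhds (t, x), (Function.uncurry fun (t : ℝ) (x : E N) => ψ x * f (x, t)) q = 0 := by
      filter_upwards [continuous_snd.continuousAt.eventually h1] with p hp
      simp [Function.uncurry, hp]
    exact (continuousAt_const (y := (0:ℝ))).congr (Filter.EventuallyEq.symm h2)

lemma time_int_zero {N : ℕ} (g : E N × ℝ → ℝ) (hg : ContDiff ℝ (⊤ : ℕ∞) g)
    (hc : HasCompactSupport g) :
    Integrable (fun p => fderiv ℝ g p (0, 1)) ∧ ∫ p, fderiv ℝ g p (0, 1) = 0 := by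
  have hcont : Continuous (fun p => fderiv ℝ g p (0, 1)) :=
    (hg.continuous_fderiv (by simp)).clm_apply continuous_const
  have hcs : HasCompactSupport (fun p => fderiv ℝ g p (0, 1)) := hc.fderiv_apply ℝ (0, 1)
  have hi := hcont.integrable_of_hasCompactSupport hcs (μ := (volume : Measure (E N × ℝ)))
  refine ⟨hi, ?_⟩
  rw [Measure.volume_eq_prod, integral_prod _ hi]
  have : ∀ x : E N, ∫ t, fderiv ℝ g (x, t) (0, 1) = 0 := by
    intro x
    have hemb : Topology.IsClosedEmbedding (fun t : ℝ => (x, t)) := Topology.IsClosedEmbedding.of_continuous_injective_isClosedMap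
      (by fun_prop) (fun a b h => (Prod.ext_iff.1 h).2) (isClosedMap_prodMk_left x)
    refine integral_eq_zero_of_hasDerivAt_of_integrable (f := fun t => g (x, t)) ?_ ?_ ?_
    · intro t
      have h1 : HasFDerivAt g (fderiv ℝ g (x, t)) (x, t) :=
        (hg.differentiable (by simp) _).hasFDerivAt
      exact h1.comp_hasDerivAt t ((hasDerivAt_const t x).prodMk (hasDerivAt_id t))
    · exact (hcont.comp (by fun_prop : Continuous fun t : ℝ => (x, t))).integrable_of_hasCompactSupport
        (hcs.comp_isClosedEmbedding hemb)
    · exact (hg.continuous.comp (by fun_prop : Continuous fun t : ℝ => (x, t))).integrable_of_hasCompactSupport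
        (hc.comp_isClosedEmbedding hemb)
  simp [this]

lemma iter_int {N : ℕ} (Ω : Set (E N)) (J : Set ℝ) (h : E N × ℝ → ℝ) (hi : Integrable h)
    (hz : ∀ p, p ∉ Ω ×ˢ J → h p = 0) :
    ∫ t in J, ∫ x in Ω, h (x, t) = ∫ p, h p := by
  have h1 : ∀ t, ∫ x in Ω, h (x, t) = ∫ x, h (x, t) := fun t =>
    setIntegral_eq_integral_of_forall_compl_eq_zero (fun x hx => hz _ (fun hh => hx hh.1))
  simp only [h1]
  rw [setIntegral_eq_integral_of_forall_compl_eq_zero, Measure.volume_eq_prod, integral_prod_symm _ hi]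
  intro t ht
  have : ∀ x, h (x, t) = 0 := fun x => hz _ (fun hh => ht hh.2)
  simp [this]

lemma iter_int2 {N : ℕ} {ψ : E N → ℝ} {χ : ℝ → ℝ} (f : E N × ℝ → ℝ)
    (hi : Integrable (fun p : E N × ℝ => ψ p.1 * χ p.2 * f p)) :
    ∫ p : E N × ℝ, ψ p.1 * χ p.2 * f p = ∫ t, χ t * ∫ x, ψ x * f (x, t) := by
  rw [Measure.volume_eq_prod, integral_prod_symm _ hi]
  congr 1; ext t
  rw [← integral_const_mul]
  congr 1; ext x; ring

/-- space derivative -/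
def Gd {N : ℕ} (u : E N → ℝ → ℝ) (p : E N × ℝ) : E N →L[ℝ] ℝ :=
  (fderiv ℝ (fun q : E N × ℝ => u q.1 q.2) p).comp (ContinuousLinearMap.inl ℝ (E N) ℝ)

def gu {N : ℕ} (u : E N → ℝ → ℝ) (p : E N × ℝ) : E N :=
  (InnerProductSpace.toDual ℝ (E N)).symm (Gd u p)

def ut {N : ℕ} (u : E N → ℝ → ℝ) (p : E N × ℝ) : ℝ :=
  fderiv ℝ (fun q : E N × ℝ => u q.1 q.2) p (0, 1)

lemma norm_gu {N : ℕ} (u : E N → ℝ → ℝ) (p : E N × ℝ) : ‖gu u p‖ = ‖Gd u p‖ := by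
  simp [gu]

lemma Gd_gu {N : ℕ} (u : E N → ℝ → ℝ) (p : E N × ℝ) : Gd u p (gu u p) = ‖gu u p‖ ^ 2 := by
  have : Gd u p (gu u p) = ⟪gu u p, gu u p⟫ := by
    conv_rhs => rw [gu, InnerProductSpace.toDual_symm_apply]
    rfl
  rw [this, real_inner_self_eq_norm_sq]

lemma slice_x {N : ℕ} {u : E N → ℝ → ℝ} {O : Set (E N × ℝ)} (hO : IsOpen O)
    (hu : ContDiffOn ℝ (⊤ : ℕ∞) (fun p : E N × ℝ => u p.1 p.2) O) {x : E N} {t : ℝ}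
    (h : (x, t) ∈ O) : HasFDerivAt (fun y => u y t) (Gd u (x, t)) x := by
  have h1 : HasFDerivAt (fun p : E N × ℝ => u p.1 p.2) _ (x, t) :=
    ((hu.contDiffAt (hO.mem_nhds h)).differentiableAt (by simp)).hasFDerivAt
  exact HasFDerivAt.comp (f := fun y : E N => (y, t)) x h1 (hasFDerivAt_prodMk_left x t)

lemma slice_t {N : ℕ} {u : E N → ℝ → ℝ} {O : Set (E N × ℝ)} (hO : IsOpen O)
    (hu : ContDiffOn ℝ (⊤ : ℕ∞) (fun p : E N × ℝ => u p.1 p.2) O) {x : E N} {t : ℝ}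
    (h : (x, t) ∈ O) : HasDerivAt (fun τ => u x τ) (ut u (x, t)) t := by
  have h1 : HasFDerivAt (fun p : E N × ℝ => u p.1 p.2) _ (x, t) :=
    ((hu.contDiffAt (hO.mem_nhds h)).differentiableAt (by simp)).hasFDerivAt
  exact h1.comp_hasDerivAt t ((hasDerivAt_const t x).prodMk (hasDerivAt_id t))

lemma cont_F {N : ℕ} {u : E N → ℝ → ℝ} {O : Set (E N × ℝ)} (hO : IsOpen O)
    (hu : ContDiffOn ℝ (⊤ : ℕ∞) (fun p : E N × ℝ => u p.1 p.2) O) :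
    ContinuousOn (ut u) O ∧ ContinuousOn (gu u) O := by
  have h1 := hu.continuousOn_fderiv_of_isOpen hO (by simp)
  constructor
  · exact h1.clm_apply continuousOn_const
  · exact (InnerProductSpace.toDual ℝ (E N)).symm.continuous.comp_continuousOn
      (h1.clm_comp continuousOn_const)

def ff1 {N : ℕ} (u : E N → ℝ → ℝ) (ψ : E N → ℝ) (l : ℝ) (p : E N × ℝ) : ℝ :=
  ψ p.1 * ut u p / (u p.1 p.2 + l)

def ff2 {N : ℕ} (u : E N → ℝ → ℝ) (ψ : E N → ℝ) (l : ℝ) (p : E N × ℝ) : ℝ :=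
  2 * fderiv ℝ ψ p.1 (gu u p) / (u p.1 p.2 + l) - ψ p.1 * ‖gu u p‖ ^ 2 / (u p.1 p.2 + l) ^ 2

lemma slice_ineq {N : ℕ} {T Cn l : ℝ} {K : E N → E N → ℝ → ℝ} {Ω : Set (E N)} {u : E N → ℝ → ℝ}
    (hsup : IsWeakSupersolution N T K Ω u) (D : Set (E N)) (I : Set ℝ) (hD : IsOpen D)
    (hI : IsOpen I) (hDΩ : D ⊆ Ω) (hIT : I ⊆ Ioo 0 T)
    (hpos : ∀ x ∈ D, ∀ t ∈ I, 0 ≤ u x t) (hl : 0 < l) (ψ : E N → ℝ)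
    (hψ : ContDiff ℝ (⊤ : ℕ∞) ψ) (hcs : HasCompactSupport ψ) (hψD : tsupport ψ ⊆ D)
    (h0 : ∀ x, 0 ≤ ψ x) (hCn : 0 ≤ Cn)
    (hnl : ∀ᵐ t ∂(volume.restrict I), ∀ χ : ℝ, 0 ≤ χ →
      ∫ x, ∫ y, (u x t - u y t) * (ψ x ^ 2 * χ / (u x t + l) - ψ y ^ 2 * χ / (u y t + l)) * K x y t
        ≤ χ * Cn) :
    ContinuousOn (ff1 u ψ l) (D ×ˢ I) ∧ ContinuousOn (ff2 u ψ l) (D ×ˢ I) ∧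
    ∀ t ∈ I, 0 ≤ (∫ x, ψ x * (ff1 u ψ l (x, t) + ff2 u ψ l (x, t))) + Cn := by
  obtain ⟨-, -, huC, hweak⟩ := hsup
  have hO : IsOpen (D ×ˢ I) := hD.prod hI
  have hu : ContDiffOn ℝ (⊤ : ℕ∞) (fun p : E N × ℝ => u p.1 p.2) (D ×ˢ I) :=
    huC.mono (prod_mono hDΩ hIT)
  obtain ⟨hut, hgu⟩ := cont_F hO hu
  have hvpos : ∀ p ∈ D ×ˢ I, 0 < u p.1 p.2 + l := fun p hp => by
    have := hpos p.1 hp.1 p.2 hp.2; linarith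
  have hvne : ∀ p ∈ D ×ˢ I, u p.1 p.2 + l ≠ 0 := fun p hp => (hvpos p hp).ne'
  have hvc : ContinuousOn (fun p : E N × ℝ => u p.1 p.2 + l) (D ×ˢ I) :=
    hu.continuousOn.add continuousOn_const
  have hψ1 : Continuous fun p : E N × ℝ => ψ p.1 := hψ.continuous.comp continuous_fst
  have hdψ : Continuous (fderiv ℝ ψ) := hψ.continuous_fderiv (by simp)
  have hf1 : ContinuousOn (ff1 u ψ l) (D ×ˢ I) :=
    (hψ1.continuousOn.mul hut).div hvc hvne
  have hf2 : ContinuousOn (ff2 u ψ l) (D ×ˢ I) := by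
    refine ((continuousOn_const.mul ((hdψ.comp continuous_fst).continuousOn.clm_apply hgu)).div hvc
      hvne).sub ((hψ1.continuousOn.mul (hgu.norm.pow 2)).div (hvc.pow 2) fun p hp => pow_ne_zero 2 (hvne p hp))
  refine ⟨hf1, hf2, ?_⟩
  have hQ : ContinuousOn (fun t => ∫ x, ψ x * (ff1 u ψ l (x, t) + ff2 u ψ l (x, t))) I := by
    refine continuousOn_integral_of_compact_support hcs
      (ext_continuousOn hD hI hψD hψ.continuous (fun p => ff1 u ψ l p + ff2 u ψ l p) (hf1.add hf2)) ?_
    intro t x _ hx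
    rw [image_eq_zero_of_notMem_tsupport hx, zero_mul]
  refine pos_of_test _ Cn I hI hQ ?_
  intro χ hχ hχc hχI hχ0
  have hsub : tsupport ψ ×ˢ tsupport χ ⊆ D ×ˢ I := prod_mono hψD hχI
  -- the test function
  have hvC : ContDiffOn ℝ (⊤ : ℕ∞) (fun p : E N × ℝ => u p.1 p.2 + l) (D ×ˢ I) :=
    hu.add contDiffOn_const
  have hψC : ContDiffOn ℝ (⊤ : ℕ∞) (fun p : E N × ℝ => ψ p.1) (D ×ˢ I) :=
    (hψ.comp contDiff_fst).contDiffOn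
  set φ : E N → ℝ → ℝ := fun x t => ψ x ^ 2 * χ t / (u x t + l) with hφ
  have hφeq : (fun p : E N × ℝ => φ p.1 p.2) =
      fun p => ψ p.1 * χ p.2 * (ψ p.1 / (u p.1 p.2 + l)) := by
    ext p; simp only [hφ]; ring
  have hφC : ContDiff ℝ (⊤ : ℕ∞) (fun p : E N × ℝ => φ p.1 p.2) := by
    rw [hφeq]; exact ext_contDiff hO hsub hψ hχ _ (hψC.div hvC hvne)
  have hφc : HasCompactSupport (fun p : E N × ℝ => φ p.1 p.2) := by
    rw [hφeq]; exact ext_compact hcs hχc (fun p : E N × ℝ => ψ p.1 / (u p.1 p.2 + l))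
  have hφt : tsupport (fun p : E N × ℝ => φ p.1 p.2) ⊆ tsupport ψ ×ˢ tsupport χ := by
    rw [hφeq]; exact ext_tsupport (fun p : E N × ℝ => ψ p.1 / (u p.1 p.2 + l))
  have hφ0 : ∀ x t, 0 ≤ φ x t := by
    intro x t
    by_cases h : (x, t) ∈ D ×ˢ I
    · have := hvpos _ h
      exact div_nonneg (mul_nonneg (sq_nonneg _) (hχ0 t)) this.le
    · have : (x, t) ∉ tsupport (fun p : E N × ℝ => φ p.1 p.2) := fun hh => h (hsub (hφt hh))
      exact (image_eq_zero_of_notMem_tsupport (f := fun p : E N × ℝ => φ p.1 p.2) this).ge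
  have key := hweak φ hφC hφc ((hφt.trans hsub).trans (prod_mono hDΩ hIT)) hφ0
  set g : E N × ℝ → ℝ := fun p => ψ p.1 * χ p.2 * (ψ p.1 * u p.1 p.2 / (u p.1 p.2 + l)) with hg
  have hgC : ContDiff ℝ (⊤ : ℕ∞) g := ext_contDiff hO hsub hψ hχ _ ((hψC.mul hu).div hvC hvne)
  have hgc : HasCompactSupport g := ext_compact hcs hχc _
  have hgt : tsupport g ⊆ tsupport ψ ×ˢ tsupport χ := ext_tsupport _
  obtain ⟨hgi, hg0⟩ := time_int_zero g hgC hgc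
  have hout : ∀ x t, (x, t) ∉ tsupport ψ ×ˢ tsupport χ → ψ x * χ t = 0 ∧
      (∀ᶠ p : E N × ℝ in nhds (x, t), φ p.1 p.2 = 0) ∧ g =ᶠ[nhds (x, t)] 0 := by
    intro x t h
    have h' : x ∉ tsupport ψ ∨ t ∉ tsupport χ := by
      by_contra hh; push Not at hh; exact h ⟨hh.1, hh.2⟩
    have := loc_zero x t h'
    refine ⟨this.self_of_nhds, ?_, ?_⟩
    · filter_upwards [this] with p hp
      have : φ p.1 p.2 = ψ p.1 * χ p.2 * (ψ p.1 / (u p.1 p.2 + l)) := congrFun hφeq p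
      rw [this, hp, zero_mul]
    · filter_upwards [this] with p hp
      simp [hg, hp]
  have hA : ∀ x t, u x t * deriv (fun τ => φ x τ) t =
      fderiv ℝ g (x, t) (0, 1) - ψ x * χ t * ff1 u ψ l (x, t) := by
    intro x t
    by_cases h : (x, t) ∈ D ×ˢ I
    · have h1 := slice_t hO hu h
      have hφd : HasDerivAt (fun τ => φ x τ) (deriv (fun τ => φ x τ) t) t := by
        apply DifferentiableAt.hasDerivAt
        have := hφC.differentiable (by simp) (x, t)
        exact DifferentiableAt.comp (f := fun τ : ℝ => (x, τ)) t this (by fun_prop)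
      have h2 := h1.mul hφd
      have h3 : HasDerivAt (fun τ => g (x, τ)) (fderiv ℝ g (x, t) (0, 1)) t :=
        (hgC.differentiable (by simp) (x, t)).hasFDerivAt.comp_hasDerivAt t
          ((hasDerivAt_const t x).prodMk (hasDerivAt_id t))
      have h4 : (fun τ => g (x, τ)) = (fun τ => u x τ) * (fun τ => φ x τ) := by
        ext τ; simp only [hg, hφ, Pi.mul_apply]; ring
      rw [h4] at h3
      have h5 := h3.unique h2
      rw [h5]; simp only [ff1, hφ]; ring
    · obtain ⟨e1, e2, e3⟩ := hout x t (fun hh => h (hsub hh))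
      have e4 : (fun τ => φ x τ) =ᶠ[nhds t] fun _ => 0 :=
        (by fun_prop : ContinuousAt (fun τ : ℝ => (x, τ)) t).eventually e2
      rw [e4.deriv_eq, e3.fderiv_eq, e1]; simp
  have hB : ∀ x t, ⟪gradient (fun y => u y t) x, gradient (fun y => φ y t) x⟫ =
      ψ x * χ t * ff2 u ψ l (x, t) := by
    intro x t
    by_cases h : (x, t) ∈ D ×ˢ I
    · have h1 := slice_x hO hu h
      have h2 : gradient (fun y => u y t) x = gu u (x, t) := by
        rw [gradient, h1.fderiv]; rfl
      have hv := hvne _ h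
      have h3 : HasFDerivAt ψ (fderiv ℝ ψ x) x := (hψ.differentiable (by simp) x).hasFDerivAt
      have h4 : HasFDerivAt (fun y => φ y t) _ x :=
        (((h3.pow 2).mul_const (χ t)).mul ((hasDerivAt_inv hv).comp_hasFDerivAt x (h1.add_const l)))
      rw [h2, gradient, h4.fderiv, real_inner_comm, InnerProductSpace.toDual_symm_apply]
      simp only [add_apply, smul_apply, smul_eq_mul, Gd_gu, ff2]
      simp
      field_simp
      ring
    · obtain ⟨e1, e2, e3⟩ := hout x t (fun hh => h (hsub hh))
      have e4 : (fun y => φ y t) =ᶠ[nhds x] fun _ => 0 :=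
        (by fun_prop : ContinuousAt (fun y : E N => (y, t)) x).eventually e2
      rw [gradient, gradient, e4.fderiv_eq, e1]; simp
  have hi1 : Integrable (fun p : E N × ℝ => ψ p.1 * χ p.2 * ff1 u ψ l p) :=
    (ext_continuous hO hsub hψ.continuous hχ.continuous _ hf1).integrable_of_hasCompactSupport
      (ext_compact hcs hχc _)
  have hi2 : Integrable (fun p : E N × ℝ => ψ p.1 * χ p.2 * ff2 u ψ l p) :=
    (ext_continuous hO hsub hψ.continuous hχ.continuous _ hf2).integrable_of_hasCompactSupport
      (ext_compact hcs hχc _)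
  have hoff : ∀ p : E N × ℝ, p ∉ Ω ×ˢ Ioo 0 T → p ∉ tsupport ψ ×ˢ tsupport χ :=
    fun p hp hh => hp (prod_mono hDΩ hIT (hsub hh))
  have t1 : ∫ t in Ioo 0 T, ∫ x in Ω, u x t * deriv (fun τ => φ x τ) t =
      - ∫ p : E N × ℝ, ψ p.1 * χ p.2 * ff1 u ψ l p := by
    simp only [hA]
    rw [iter_int Ω (Ioo 0 T) (fun p => fderiv ℝ g p (0, 1) - ψ p.1 * χ p.2 * ff1 u ψ l p) (hgi.sub hi1),
      integral_sub hgi hi1, hg0, zero_sub]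
    intro p hp
    obtain ⟨e1, e2, e3⟩ := hout p.1 p.2 (hoff p hp)
    rw [e1, e3.fderiv_eq]; simp
  have t2 : ∫ t in Ioo 0 T, ∫ x in Ω,
      ⟪gradient (fun y => u y t) x, gradient (fun y => φ y t) x⟫ =
      ∫ p : E N × ℝ, ψ p.1 * χ p.2 * ff2 u ψ l p := by
    simp only [hB]
    rw [iter_int Ω (Ioo 0 T) (fun p => ψ p.1 * χ p.2 * ff2 u ψ l p) hi2]
    intro p hp
    obtain ⟨e1, e2, e3⟩ := hout p.1 p.2 (hoff p hp)
    rw [e1, zero_mul]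
  have hχi : Integrable (fun t => χ t * Cn) :=
    (hχ.continuous.integrable_of_hasCompactSupport hχc).mul_const Cn
  have t3 : ∫ t in Ioo 0 T, ∫ x : E N, ∫ y : E N,
          (u x t - u y t) * (φ x t - φ y t) * K x y t ≤ ∫ t, χ t * Cn := by
    have hz : ∀ t, t ∉ I → ∫ x : E N, ∫ y : E N,
          (u x t - u y t) * (φ x t - φ y t) * K x y t = 0 := by
      intro t ht
      have : χ t = 0 := image_eq_zero_of_notMem_tsupport fun hh => ht (hχI hh)
      simp [hφ, this]
    rw [setIntegral_eq_integral_of_forall_compl_eq_zero fun t ht => hz t fun hh => ht (hIT hh)]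
    set Z := fun t => ∫ x : E N, ∫ y : E N, (u x t - u y t) * (φ x t - φ y t) * K x y t with hZ
    have hle : ∀ᵐ t, Z t ≤ χ t * Cn := by
      rw [ae_restrict_iff' hI.measurableSet] at hnl
      filter_upwards [hnl] with t ht
      by_cases h : t ∈ I
      · exact ht h (χ t) (hχ0 t)
      · simp only [hZ]; rw [hz t h]; exact mul_nonneg (hχ0 t) hCn
    by_cases hZi : Integrable Z
    · exact integral_mono_ae hZi hχi hle
    · rw [integral_undef hZi]; exact integral_nonneg fun t => mul_nonneg (hχ0 t) hCn
  have t4 : ∫ t, χ t * ((∫ x, ψ x * (ff1 u ψ l (x, t) + ff2 u ψ l (x, t))) + Cn) =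
      (∫ p : E N × ℝ, ψ p.1 * χ p.2 * ff1 u ψ l p) + (∫ p : E N × ℝ, ψ p.1 * χ p.2 * ff2 u ψ l p) +
        ∫ t, χ t * Cn := by
    have hi3 : Integrable (fun p : E N × ℝ => ψ p.1 * χ p.2 * (ff1 u ψ l p + ff2 u ψ l p)) := by
      refine (hi1.add hi2).congr (Filter.Eventually.of_forall fun p => ?_)
      simp only [Pi.add_apply]; ring
    rw [← integral_add hi1 hi2]
    have e1 : ∀ p : E N × ℝ, ψ p.1 * χ p.2 * ff1 u ψ l p + ψ p.1 * χ p.2 * ff2 u ψ l p =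
      ψ p.1 * χ p.2 * (ff1 u ψ l p + ff2 u ψ l p) := fun p => by ring
    simp only [e1]
    rw [iter_int2 (fun p => ff1 u ψ l p + ff2 u ψ l p) hi3, ← integral_add _ hχi]
    · simp only [mul_add]
    · have := hi3.integral_prod_right
      refine this.congr (Filter.Eventually.of_forall fun t => ?_)
      simp only []
      rw [← integral_const_mul]
      congr 1; ext x; ring
  rw [t4]
  rw [t1, t2] at key
  linarith

lemma energy {N : ℕ} {Cn l : ℝ} {u : E N → ℝ → ℝ}
    (D : Set (E N)) (I : Set ℝ) (hD : IsOpen D)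
    (hI : IsOpen I) (hu : ContDiffOn ℝ (⊤ : ℕ∞) (fun p : E N × ℝ => u p.1 p.2) (D ×ˢ I))
    (hpos : ∀ x ∈ D, ∀ t ∈ I, 0 ≤ u x t) (hl : 0 < l) (ψ : E N → ℝ)
    (hψ : ContDiff ℝ (⊤ : ℕ∞) ψ) (hcs : HasCompactSupport ψ) (hψD : tsupport ψ ⊆ D)
    (h0 : ∀ x, 0 ≤ ψ x)
    (hf1 : ContinuousOn (ff1 u ψ l) (D ×ˢ I)) (hf2 : ContinuousOn (ff2 u ψ l) (D ×ˢ I))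
    (h : ∀ t ∈ I, 0 ≤ (∫ x, ψ x * (ff1 u ψ l (x, t) + ff2 u ψ l (x, t))) + Cn) :
    ∀ t ∈ I, (1 / 2) * (∫ z, ψ z ^ 2 * ‖fderiv ℝ (fun x => Real.log (u x t + l)) z‖ ^ 2) ≤
      (∫ x, ψ x * ff1 u ψ l (x, t)) + Cn + 2 * ∫ x, ‖fderiv ℝ ψ x‖ ^ 2 := by
  intro t ht
  have hO : IsOpen (D ×ˢ I) := hD.prod hI
  obtain ⟨-, hgu⟩ := cont_F hO hu
  have hvpos : ∀ p ∈ D ×ˢ I, 0 < u p.1 p.2 + l := fun p hp => by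
    have := hpos p.1 hp.1 p.2 hp.2; linarith
  have hvc : ContinuousOn (fun p : E N × ℝ => u p.1 p.2 + l) (D ×ˢ I) :=
    hu.continuousOn.add continuousOn_const
  have hint : ∀ f : E N × ℝ → ℝ, ContinuousOn f (D ×ˢ I) → Integrable fun x => ψ x * f (x, t) := by
    intro f hf
    have h1 := ext_continuousOn hD hI hψD hψ.continuous f hf
    have h2 : Continuous fun x => ψ x * f (x, t) := by
      rw [← continuousOn_univ]
      exact h1.comp (f := fun x : E N => (t, x)) (by fun_prop) (fun x _ => ⟨ht, mem_univ _⟩)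
    exact h2.integrable_of_hasCompactSupport hcs.mul_right
  have hψ1 : Continuous fun p : E N × ℝ => ψ p.1 := hψ.continuous.comp continuous_fst
  have hi1 := hint _ hf1
  have hi2 := hint _ hf2
  have hi3 := hint (fun p => ψ p.1 * (‖gu u p‖ / (u p.1 p.2 + l)) ^ 2)
    (hψ1.continuousOn.mul ((hgu.norm.div hvc fun p hp => (hvpos p hp).ne').pow 2))
  have hdψ : Continuous (fderiv ℝ ψ) := hψ.continuous_fderiv (by simp)
  have hi4 : Integrable fun x => ‖fderiv ℝ ψ x‖ ^ 2 := by
    refine (by fun_prop : Continuous fun x => ‖fderiv ℝ ψ x‖ ^ 2).integrable_of_hasCompactSupport ?_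
    refine (hcs.fderiv (𝕜 := ℝ)).mono ?_
    intro x hx hx0
    exact hx (by simp [hx0])
  have eP : ∀ z, ψ z ^ 2 * ‖fderiv ℝ (fun x => Real.log (u x t + l)) z‖ ^ 2 =
      ψ z * (ψ z * (‖gu u (z, t)‖ / (u z t + l)) ^ 2) := by
    intro z
    by_cases hz : z ∈ D
    · have hv := hvpos (z, t) ⟨hz, ht⟩
      have h1 : HasFDerivAt (fun x => Real.log (u x t + l)) ((u z t + l)⁻¹ • Gd u (z, t)) z :=
        ((slice_x hO hu (x := z) (t := t) ⟨hz, ht⟩).add_const l).log hv.ne'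
      rw [h1.fderiv, norm_smul, norm_gu, Real.norm_eq_abs, abs_of_pos (inv_pos.2 hv), div_eq_inv_mul]
      ring
    · rw [image_eq_zero_of_notMem_tsupport fun hh => hz (hψD hh)]; simp
  simp only [eP]
  have hsplit : ∫ x, ψ x * (ff1 u ψ l (x, t) + ff2 u ψ l (x, t)) =
      (∫ x, ψ x * ff1 u ψ l (x, t)) + ∫ x, ψ x * ff2 u ψ l (x, t) := by
    rw [← integral_add hi1 hi2]; simp only [mul_add]
  have h2 : ∫ x, ψ x * ff2 u ψ l (x, t) ≤
      ∫ x, (-(1 / 2) * (ψ x * (ψ x * (‖gu u (x, t)‖ / (u x t + l)) ^ 2)) + 2 * ‖fderiv ℝ ψ x‖ ^ 2) := by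
    refine integral_mono hi2 ((hi3.const_mul _).add (hi4.const_mul _)) ?_
    intro x
    by_cases hz : x ∈ D
    · have hv := hvpos (x, t) ⟨hz, ht⟩
      simp only [ff2] at hv ⊢
      have hle : fderiv ℝ ψ x (gu u (x, t)) ≤ ‖fderiv ℝ ψ x‖ * ‖gu u (x, t)‖ :=
        (le_abs_self _).trans ((fderiv ℝ ψ x).le_opNorm _)
      have hle2 : fderiv ℝ ψ x (gu u (x, t)) / (u x t + l) ≤
          ‖fderiv ℝ ψ x‖ * (‖gu u (x, t)‖ / (u x t + l)) := by
        rw [← mul_div_assoc]; exact div_le_div_of_nonneg_right hle hv.le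
      have e : 2 * fderiv ℝ ψ x (gu u (x, t)) / (u x t + l) - ψ x * ‖gu u (x, t)‖ ^ 2 / (u x t + l) ^ 2
        = 2 * (fderiv ℝ ψ x (gu u (x, t)) / (u x t + l)) - ψ x * (‖gu u (x, t)‖ / (u x t + l)) ^ 2 := by
        rw [div_pow]; ring
      rw [e]
      set a := ‖gu u (x, t)‖ / (u x t + l)
      nlinarith [mul_le_mul_of_nonneg_left hle2 (h0 x), sq_nonneg (ψ x * a - 2 * ‖fderiv ℝ ψ x‖)]
    · simp only [image_eq_zero_of_notMem_tsupport fun hh => hz (hψD hh)]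
      simp
  rw [integral_add (hi3.const_mul _) (hi4.const_mul _), integral_const_mul, integral_const_mul] at h2
  have := h t ht
  linarith

lemma lip_psi {N : ℕ} (ψ : E N → ℝ) (hψ : ContDiff ℝ (⊤ : ℕ∞) ψ) {c : ℝ} (hc : 0 ≤ c) (B : Set (E N))
    (hB : tsupport ψ ⊆ B) (h : ∀ x ∈ B, ‖gradient ψ x‖ ≤ c) :
    (∀ x, ‖fderiv ℝ ψ x‖ ≤ c) ∧ ∀ x y, |ψ x - ψ y| ≤ c * ‖x - y‖ := by
  have h1 : ∀ x, ‖fderiv ℝ ψ x‖ ≤ c := by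
    intro x
    by_cases hx : x ∈ B
    · have := h x hx
      simpa [gradient] using this
    · have : fderiv ℝ ψ x = 0 := by
        have := (notMem_tsupport_iff_eventuallyEq.1 fun hh => hx (hB hh)).fderiv_eq (𝕜 := ℝ)
        rw [this]; simp
      rw [this]; simpa using hc
  refine ⟨h1, fun x y => ?_⟩
  have := convex_univ.norm_image_sub_le_of_norm_fderiv_le (f := ψ) (𝕜 := ℝ) (C := c)
    (fun z _ => hψ.differentiable (by simp) z) (fun z _ => h1 z) (mem_univ y) (mem_univ x)
  simpa using this

lemma vol_ball {N : ℕ} (x₀ : E N) {ρ : ℝ} (hρ : 0 < ρ) :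
    (volume (ball x₀ ρ)).toReal = ρ ^ N * (volume (ball (0 : E N) 1)).toReal := by
  rw [Measure.addHaar_ball_of_pos volume x₀ hρ, ENNReal.toReal_mul, ENNReal.toReal_ofReal (by positivity),
    finrank_euclideanSpace_fin]

set_option maxHeartbeats 1000000 in
theorem stmt_14 (N : ℕ) (hN : 2 ≤ N) (s Λ C₀ : ℝ) (hs : s ∈ Set.Ioo (0 : ℝ) 1)
    (hΛ : 1 ≤ Λ) (hC₀ : 0 < C₀) :
    ∃ C : ℝ, 0 < C ∧
      ∀ (T : ℝ) (Ω : Set (E N)) (K : E N → E N → ℝ → ℝ) (u : E N → ℝ → ℝ)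
        (x₀ : E N) (R r t₀ d l : ℝ) (ψ : E N → ℝ),
        0 < T → IsOpen Ω → Bornology.IsBounded Ω →
        KernelOK N s Λ T K → IsWeakSupersolution N T K Ω u →
        Metric.ball x₀ R ⊆ Ω → Set.Ioo (t₀ - r ^ 2) (t₀ + r ^ 2) ⊆ Set.Ioo 0 T →
        (∀ x ∈ Metric.ball x₀ R, ∀ t ∈ Set.Ioo (t₀ - r ^ 2) (t₀ + r ^ 2), 0 ≤ u x t) →
        0 < r → r ≤ 1 → r < R / 2 → 0 < d →
        l = (r / R) ^ 2 * tailInfty N s (uminus N u) x₀ R (t₀ - r ^ 2) (t₀ + r ^ 2) + d →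
        ContDiff ℝ (⊤ : ℕ∞) ψ → HasCompactSupport ψ →
        tsupport ψ ⊆ Metric.ball x₀ (3 * r / 2) →
        (∀ x, 0 ≤ ψ x) → (∀ x, ψ x ≤ 1) →
        (∃ g : ℝ → ℝ, AntitoneOn g (Set.Ici 0) ∧ ∀ x, ψ x = g ‖x - x₀‖) →
        (∀ x ∈ Metric.ball x₀ r, ψ x = 1) →
        (∀ x ∈ Metric.ball x₀ (3 * r / 2), ‖gradient ψ x‖ ≤ C₀ / r) →
        ∀ lam : ℝ, 0 < lam →
          volume {p : E N × ℝ |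
              p ∈ (Metric.ball x₀ r) ×ˢ Set.Ioo t₀ (t₀ + r ^ 2) ∧
              Real.log (u p.1 p.2 + l) <
                -lam -
                  (-(∫ x in Metric.ball x₀ (3 * r / 2), Real.log (u x t₀ + l) * ψ x ^ 2) /
                    ∫ x in Metric.ball x₀ (3 * r / 2), ψ x ^ 2)} ≤
            ENNReal.ofReal (C * r ^ (N + 2) / lam) := by

  set M₀ : ℝ := ∫ z : E N, min (C₀ ^ 2 * ‖z‖ ^ 2) 1 * ‖z‖ ^ (-((N : ℝ) + 2 * s)) with hM₀d
  have hJnn : ∀ z : E N, 0 ≤ min (C₀ ^ 2 * ‖z‖ ^ 2) 1 * ‖z‖ ^ (-((N : ℝ) + 2 * s)) := fun z => by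
    positivity
  have hM₀ : 0 ≤ M₀ := integral_nonneg hJnn
  have hJ : ∫⁻ z : E N, ENNReal.ofReal (min (C₀ ^ 2 * ‖z‖ ^ 2) 1 * ‖z‖ ^ (-((N : ℝ) + 2 * s))) ≤
      ENNReal.ofReal M₀ := by
    rw [hM₀d, ofReal_integral_eq_lintegral_ofReal (J_integrable hN hs hC₀)
      (Filter.Eventually.of_forall hJnn)]
  set ω : ℝ := (volume (ball (0 : E N) 1)).toReal with hω
  have hω0 : 0 < ω := ENNReal.toReal_pos (measure_ball_pos volume _ one_pos).ne' measure_ball_lt_top.ne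
  set C2 : ℝ := 2 * (Λ * M₀ + Λ * 4 ^ ((N : ℝ) + 2 * s)) with hC2
  have hC20 : 0 ≤ C2 := by positivity
  set C1 : ℝ := (C2 + 2 * C₀ ^ 2) * (3 / 2) ^ N with hC1
  have hC10 : 0 ≤ C1 := by positivity
  set Q0 : ℝ := 18 * 3 ^ N * (3 / 2) ^ N * ω with hQ0
  have hQ00 : 0 < Q0 := by positivity
  refine ⟨2 * Q0 + 2 * C1 * ω, by positivity, ?_⟩
  intro T Ω K u x₀ R r t₀ d l ψ hT hΩ hΩb hK hsup hBΩ hIT hpos hr hr1 hrR hd hl hψ hcs hts h0 h1 hg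
    hone hgrad lam hlam
  obtain ⟨hKm, hKs, hKb⟩ := hK
  have hsup' := hsup
  obtain ⟨hum, ⟨M, hM⟩, huC, -⟩ := hsup'
  have hR : 0 < R := by linarith
  have hr2 : 0 < r ^ 2 := by positivity
  set I : Set ℝ := Ioo (t₀ - r ^ 2) (t₀ + r ^ 2) with hIdef
  set D : Set (E N) := ball x₀ R with hDdef
  have hI : IsOpen I := isOpen_Ioo
  have hD : IsOpen D := isOpen_ball
  have hBD : ball x₀ (3 * r / 2) ⊆ D := ball_subset_ball (by linarith)
  have hψD : tsupport ψ ⊆ D := hts.trans hBD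
  have hz : ∀ x, x ∉ ball x₀ (3 * r / 2) → ψ x = 0 := fun x hx =>
    image_eq_zero_of_notMem_tsupport fun hh => hx (hts hh)
  obtain ⟨σ, hσ, hlσ, htail⟩ := tail_lemma hN hs u hum M (t₀ - r ^ 2) (t₀ + r ^ 2) (by linarith)
    (fun x t ht => hM x t (hIT ht)) x₀ hR hl
  have hl0 : 0 < l := by rw [hlσ]; positivity
  obtain ⟨hdψ, hlip⟩ := lip_psi ψ hψ (by positivity : 0 ≤ C₀ / r) _ hts hgrad
  set b : ℝ := (volume (ball x₀ (3 * r / 2))).toReal with hb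
  have hbv : b = (3 / 2) ^ N * r ^ N * ω := by
    rw [hb, vol_ball x₀ (by positivity), ← mul_pow]; congr 2; ring
  have hb0 : 0 < b := by rw [hbv]; positivity
  have hnl : ∀ᵐ t ∂(volume.restrict I), ∀ χ : ℝ, 0 ≤ χ →
      ∫ x, ∫ y, (u x t - u y t) * (ψ x ^ 2 * χ / (u x t + l) - ψ y ^ 2 * χ / (u y t + l)) * K x y t
        ≤ χ * (C2 / r ^ 2 * b) := by
    filter_upwards [htail, ae_restrict_mem hI.measurableSet] with t ht htI χ hχ
    exact nonlocal_bound hs hΛ hC₀ hM₀ hJ x₀ hr hr1 hrR hl0 hσ (by rw [hlσ]; linarith)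
      (fun x => u x t) (hum.comp (by fun_prop : Measurable fun x : E N => (x, t)))
      (fun x hx => hpos x hx t htI) ht (fun x y => K x y t) (fun x y => hKs x y t)
      (fun x y hxy => hKb x y hxy t (hIT htI)) ψ h0 h1 hz hlip χ hχ
  obtain ⟨hf1, hf2, hsl⟩ := slice_ineq hsup D I hD hI hBΩ hIT hpos hl0 ψ hψ hcs hψD h0
    (by positivity) hnl
  have hu : ContDiffOn ℝ (⊤ : ℕ∞) (fun p : E N × ℝ => u p.1 p.2) (D ×ˢ I) :=
    huC.mono (prod_mono hBΩ hIT)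
  have hen := energy D I hD hI hu hpos hl0 ψ hψ hcs hψD h0 hf1 hf2 hsl
  have hO : IsOpen (D ×ˢ I) := hD.prod hI
  have hvpos : ∀ p ∈ D ×ˢ I, 0 < u p.1 p.2 + l := fun p hp => by
    have := hpos p.1 hp.1 p.2 hp.2; linarith
  -- gradient integral
  have hfin : volume (ball x₀ (3 * r / 2)) < ⊤ := measure_ball_lt_top
  have hgi : ∫ x, ‖fderiv ℝ ψ x‖ ^ 2 ≤ (C₀ / r) ^ 2 * b := by
    rw [← setIntegral_eq_integral_of_forall_compl_eq_zero (s := ball x₀ (3 * r / 2))]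
    · refine (le_abs_self _).trans ?_
      refine norm_setIntegral_le_of_norm_le_const (μ := volume) (s := ball x₀ (3 * r / 2))
        (f := fun x => ‖fderiv ℝ ψ x‖ ^ 2) (C := (C₀ / r) ^ 2) hfin (fun x _ => ?_)
      rw [Real.norm_eq_abs, abs_of_nonneg (sq_nonneg _)]
      exact pow_le_pow_left₀ (norm_nonneg _) (hdψ x) 2
    · intro x hx
      have := (notMem_tsupport_iff_eventuallyEq.1 fun hh => hx (hts hh)).fderiv_eq (𝕜 := ℝ)
      rw [this]; simp
  set A : ℝ := ∫ x, ψ x ^ 2 with hA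
  have hAi : Integrable fun x => ψ x ^ 2 := by
    refine (hψ.continuous.pow 2).integrable_of_hasCompactSupport ?_
    simp only [pow_two]; exact hcs.mul_right
  have hAb : A ≤ b := by
    rw [hA, ← setIntegral_eq_integral_of_forall_compl_eq_zero (s := ball x₀ (3 * r / 2))
      (fun x hx => by rw [hz x hx]; simp)]
    refine (le_abs_self _).trans ?_
    refine (norm_setIntegral_le_of_norm_le_const (μ := volume) (s := ball x₀ (3 * r / 2))
        (f := fun x => ψ x ^ 2) (C := 1) hfin (fun x _ => ?_)).trans_eq (one_mul _)
    rw [Real.norm_eq_abs, abs_of_nonneg (sq_nonneg _)]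
    exact pow_le_one₀ (h0 x) (h1 x)
  have hAl : r ^ N * ω ≤ A := by
    have e1 : ∫ x in ball x₀ r, ψ x ^ 2 = r ^ N * ω := by
      rw [← vol_ball x₀ hr, setIntegral_congr_fun (g := fun _ => (1 : ℝ)) measurableSet_ball
        (fun x hx => by simp only []; rw [hone x hx]; norm_num)]
      simp [Measure.real]
    rw [← e1]
    exact setIntegral_le_integral hAi (Filter.Eventually.of_forall fun x => sq_nonneg _)
  have hA0 : 0 < A := lt_of_lt_of_le (by positivity) hAl
  have hbA : b ≤ (3 / 2) ^ N * A := by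
    rw [hbv, mul_assoc]; exact mul_le_mul_of_nonneg_left hAl (by positivity)
  set w : E N → ℝ → ℝ := fun x t => Real.log (u x t + l) with hw
  have hwm : Measurable (fun p : E N × ℝ => w p.1 p.2) := Real.measurable_log.comp (hum.add_const l)
  have hwc : ContinuousOn (fun p : E N × ℝ => w p.1 p.2) (D ×ˢ I) :=
    (hu.continuousOn.add continuousOn_const).log fun p hp => (hvpos p hp).ne'
  have hψ1 : Continuous fun p : E N × ℝ => ψ p.1 := hψ.continuous.comp continuous_fst
  set V : ℝ → ℝ := fun t => (∫ x, w x t * ψ x ^ 2) / A with hV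
  set V' : ℝ → ℝ := fun t => (∫ x, ψ x * ff1 u ψ l (x, t)) / A with hV'
  have hsubI : Ico t₀ (t₀ + r ^ 2) ⊆ I := fun t ht => ⟨by linarith [ht.1], ht.2⟩
  have hVd : ∀ t ∈ Ico t₀ (t₀ + r ^ 2), HasDerivAt V (V' t) t := by
    intro t ht
    have hp := param_deriv (fun t x => ψ x * (ψ x * w x t)) (fun t x => ψ x * ff1 u ψ l (x, t)) I hI
      (tsupport ψ) hcs
      (ext_continuousOn hD hI hψD hψ.continuous (fun p => ψ p.1 * w p.1 p.2) (hψ1.continuousOn.mul hwc))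
      (ext_continuousOn hD hI hψD hψ.continuous _ hf1)
      (fun t _ x hx => by rw [image_eq_zero_of_notMem_tsupport hx, zero_mul])
      (fun t _ x hx => by rw [image_eq_zero_of_notMem_tsupport hx, zero_mul]) ?_ t (hsubI ht)
    · have e : (fun t => ∫ x, ψ x * (ψ x * w x t)) = fun t => ∫ x, w x t * ψ x ^ 2 := by
        ext t; congr 1; ext x; ring
      rw [e] at hp
      exact hp.div_const A
    · intro t ht x
      by_cases hx : x ∈ D
      · have hd := ((slice_t hO hu (x := x) (t := t) ⟨hx, ht⟩).add_const l).log
          (hvpos (x, t) ⟨hx, ht⟩).ne'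
        have e0 : ψ x * ff1 u ψ l (x, t) = ψ x * (ψ x * (ut u (x, t) / (u x t + l))) := by
          simp only [ff1]; ring
        rw [e0]
        exact (hd.const_mul (ψ x)).const_mul (ψ x)
      · have : ψ x = 0 := image_eq_zero_of_notMem_tsupport fun hh => hx (hψD hh)
        have e0 : (fun τ => ψ x * (ψ x * w x τ)) = fun _ => 0 := by ext τ; rw [this, zero_mul]
        rw [e0, this, zero_mul]
        exact hasDerivAt_const t 0
  have hPk : ∀ t ∈ I, (1 / 2) * (∫ z, ψ z ^ 2 * ‖fderiv ℝ (fun x => w x t) z‖ ^ 2) ≤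
      A * (V' t + C1 / r ^ 2) := by
    intro t ht
    have e1 := hen t ht
    have e2 : A * V' t = ∫ x, ψ x * ff1 u ψ l (x, t) := by
      exact mul_div_cancel₀ _ hA0.ne'
    have e3 : C2 / r ^ 2 * b + 2 * ((C₀ / r) ^ 2 * b) ≤ A * (C1 / r ^ 2) := by
      have : C2 / r ^ 2 * b + 2 * ((C₀ / r) ^ 2 * b) = (C2 + 2 * C₀ ^ 2) / r ^ 2 * b := by
        rw [div_pow]; ring
      rw [this]
      calc (C2 + 2 * C₀ ^ 2) / r ^ 2 * b ≤ (C2 + 2 * C₀ ^ 2) / r ^ 2 * ((3 / 2) ^ N * A) :=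
            mul_le_mul_of_nonneg_left hbA (by positivity)
        _ = A * (C1 / r ^ 2) := by rw [hC1]; ring
    rw [mul_add, e2]
    linarith
  have hVpos : ∀ t ∈ I, 0 ≤ V' t + C1 / r ^ 2 := by
    intro t ht
    have e1 := hPk t ht
    have e2 : 0 ≤ ∫ z, ψ z ^ 2 * ‖fderiv ℝ (fun x => w x t) z‖ ^ 2 :=
      integral_nonneg fun z => by positivity
    exact nonneg_of_mul_nonneg_right (by linarith : 0 ≤ A * (V' t + C1 / r ^ 2)) hA0
  set Q : ℝ := 18 * 3 ^ N * r ^ 2 * b with hQ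
  have hQ0' : Q = Q0 * r ^ (N + 2) := by rw [hQ, hbv, hQ0]; ring
  have hP : ∀ t ∈ Ico t₀ (t₀ + r ^ 2), ∫⁻ x in ball x₀ r, ENNReal.ofReal ((w x t - V t) ^ 2) ≤
      ENNReal.ofReal (Q * (V' t + C1 / r ^ 2)) := by
    intro t ht
    have htI := hsubI ht
    have hwC : ContDiffOn ℝ 1 (fun x => w x t) (ball x₀ R) := by
      have h2 : ContDiffOn ℝ 1 (fun x => u x t) (ball x₀ R) :=
        (hu.of_le (by exact_mod_cast le_top)).comp (f := fun x : E N => (x, t))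
          (by fun_prop) (fun x hx => ⟨hx, htI⟩)
      exact (h2.add contDiffOn_const).log fun x hx => (hvpos (x, t) ⟨hx, htI⟩).ne'
    refine (poincare_weighted hN x₀ hr (by linarith) (fun x => w x t) ψ hwC hψ.continuous hcs hts h0 h1
      hg hone).trans (ENNReal.ofReal_le_ofReal ?_)
    have e1 := hPk t htI
    have e2 := hVpos t htI
    have e3 : A * (V' t + C1 / r ^ 2) ≤ b * (V' t + C1 / r ^ 2) := mul_le_mul_of_nonneg_right hAb e2
    calc 9 * r ^ 2 * 3 ^ N * ∫ z, ψ z ^ 2 * ‖fderiv ℝ (fun x => w x t) z‖ ^ 2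
        = 18 * r ^ 2 * 3 ^ N * ((1 / 2) * ∫ z, ψ z ^ 2 * ‖fderiv ℝ (fun x => w x t) z‖ ^ 2) := by ring
      _ ≤ 18 * r ^ 2 * 3 ^ N * (b * (V' t + C1 / r ^ 2)) :=
          mul_le_mul_of_nonneg_left (e1.trans e3) (by positivity)
      _ = Q * (V' t + C1 / r ^ 2) := by rw [hQ]; ring
  have eset : -lam - (-(∫ x in ball x₀ (3 * r / 2), Real.log (u x t₀ + l) * ψ x ^ 2) /
                    ∫ x in ball x₀ (3 * r / 2), ψ x ^ 2) = V t₀ - lam := by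
    rw [setIntegral_eq_integral_of_forall_compl_eq_zero (fun x hx => by rw [hz x hx]; simp),
      setIntegral_eq_integral_of_forall_compl_eq_zero (fun x hx => by rw [hz x hx]; simp)]
    simp only [hV, hw]; ring
  rw [eset]
  rcases lt_or_ge (2 * C1) lam with hc | hc
  · have hlam' : 0 < lam - C1 := by linarith
    have := ode_measure (ball x₀ r) measurableSet_ball measure_ball_lt_top.ne t₀ (r ^ 2) C1 Q hr2 hC10
      (by positivity) w hwm V V' hVd (fun t ht => hVpos t (hsubI ht)) hP (lam - C1) hlam'
    have e : V t₀ - (lam - C1) - C1 = V t₀ - lam := by ring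
    rw [e] at this
    refine this.trans (ENNReal.ofReal_le_ofReal ?_)
    rw [div_le_div_iff₀ hlam' hlam, hQ0']
    have : 0 < r ^ (N + 2) := by positivity
    have h3 : 0 ≤ 2 * C1 * ω * r ^ (N + 2) * (lam - C1) := by positivity
    have h4 : Q0 * r ^ (N + 2) * lam ≤ Q0 * r ^ (N + 2) * (2 * (lam - C1)) :=
      mul_le_mul_of_nonneg_left (by linarith) (by positivity)
    have e5 : (2 * Q0 + 2 * C1 * ω) * r ^ (N + 2) * (lam - C1) =
      Q0 * r ^ (N + 2) * (2 * (lam - C1)) + 2 * C1 * ω * r ^ (N + 2) * (lam - C1) := by ring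
    rw [e5]; linarith only [h3, h4]
  · refine (measure_mono (t := ball x₀ r ×ˢ Ioo t₀ (t₀ + r ^ 2)) fun p hp => hp.1).trans ?_
    rw [Measure.volume_eq_prod, Measure.prod_prod, Real.volume_Ioo,
      ← ENNReal.ofReal_toReal (measure_ball_lt_top (x := x₀) (r := r) (μ := volume)).ne,
      vol_ball x₀ hr, ← ENNReal.ofReal_mul (by positivity)]
    apply ENNReal.ofReal_le_ofReal
    rw [le_div_iff₀ hlam]
    have e : r ^ N * ω * (t₀ + r ^ 2 - t₀) = ω * r ^ (N + 2) := by ring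
    rw [e]
    have h4 : ω * r ^ (N + 2) * lam ≤ ω * r ^ (N + 2) * (2 * C1) :=
      mul_le_mul_of_nonneg_left hc (by positivity)
    have h3 : 0 ≤ 2 * Q0 * r ^ (N + 2) := by positivity
    have e5 : (2 * Q0 + 2 * C1 * ω) * r ^ (N + 2) =
      ω * r ^ (N + 2) * (2 * C1) + 2 * Q0 * r ^ (N + 2) := by ring
    rw [e5]; linarith only [h3, h4]
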